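/- arXiv:2506.11324 — 3 statements merged into one kernel-verified Lean document; each statement's English description precedes it below -/
import Mathlib

section
/- Non-vanishing of spin correlations with topological disorder insertions (Lemma 2.6): For any discrete torus 𝕋^δ, any even n > 0, any pairwise distinct vertices v₁, …, vₙ ∈ 𝕋^δ, and any (p,q) ∈ {0,1}², one has E_{𝕋^δ}[σ_{v₁} ⋯ σ_{vₙ} μ^{(p,q)}] ≠ 0. -/
noncomputable section

open Complex Filter Topology

/-! ## Discrete torus Ising model -/

def chi (b : Bool) : ℝ := if b then 1 else -1

def betaC : ℝ := Real.log (Real.sqrt 2 + 1) / 2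

def emb (δ : ℝ) (w : ℤ × ℤ) : ℂ :=
  (δ : ℂ) * (1 + Complex.I) * ((w.1 : ℂ) + (w.2 : ℂ) * Complex.I)

abbrev TorusV (L : AddSubgroup (ℤ × ℤ)) : Type := (ℤ × ℤ) ⧸ L

def e1 (L : AddSubgroup (ℤ × ℤ)) : TorusV L := QuotientAddGroup.mk ((1, 0) : ℤ × ℤ)

def e2 (L : AddSubgroup (ℤ × ℤ)) : TorusV L := QuotientAddGroup.mk ((0, 1) : ℤ × ℤ)

def torusEnergy (L : AddSubgroup (ℤ × ℤ)) (σ : TorusV L → Bool) : ℝ :=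
  ∑ᶠ x : TorusV L,
    (chi (σ x) * chi (σ (x + e1 L)) + chi (σ x) * chi (σ (x + e2 L)))

def torusExp (L : AddSubgroup (ℤ × ℤ)) (β : ℝ) (f : (TorusV L → Bool) → ℝ) : ℝ :=
  (∑ᶠ σ : TorusV L → Bool, f σ * Real.exp (β * torusEnergy L σ)) /
    ∑ᶠ σ : TorusV L → Bool, Real.exp (β * torusEnergy L σ)

def spinProd (L : AddSubgroup (ℤ × ℤ)) {n : ℕ} (v : Fin n → TorusV L)
    (σ : TorusV L → Bool) : ℝ :=
  ∏ i, chi (σ (v i))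

/-! ## Disorder loops -/

def stepSet : Set (ℤ × ℤ) := {(1, 0), (-1, 0), (0, 1), (0, -1)}

structure DualLoop (L : AddSubgroup (ℤ × ℤ)) (w : ℤ × ℤ) : Type where
  len : ℕ
  lenPos : 0 < len
  pos : ℤ → ℤ × ℤ
  per : ∀ t, pos (t + len) = pos t + w
  step : ∀ t, pos (t + 1) - pos t ∈ stepSet
  simple : ∀ t t' : ℤ, 0 ≤ t → t < t' → t' < (len : ℤ) → pos t' - pos t ∉ L

def edgeDir (L : AddSubgroup (ℤ × ℤ)) (b : Bool) : TorusV L := if b then e2 L else e1 L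

def crossEdge (L : AddSubgroup (ℤ × ℤ)) (d d' : ℤ × ℤ) : TorusV L × Bool :=
  if d' - d = (1, 0) then (QuotientAddGroup.mk (d + (1, 0)), true)
  else if d' - d = (-1, 0) then (QuotientAddGroup.mk d, true)
  else if d' - d = (0, 1) then (QuotientAddGroup.mk (d + (0, 1)), false)
  else (QuotientAddGroup.mk d, false)

def crossedEdges {L : AddSubgroup (ℤ × ℤ)} {w : ℤ × ℤ} (γ : DualLoop L w) :
    Set (TorusV L × Bool) :=
  {e | ∃ t : ℤ, 0 ≤ t ∧ t < (γ.len : ℤ) ∧ e = crossEdge L (γ.pos t) (γ.pos (t + 1))}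

def disorderWeight (L : AddSubgroup (ℤ × ℤ)) (β : ℝ) (E : Set (TorusV L × Bool))
    (σ : TorusV L → Bool) : ℝ :=
  Real.exp (-2 * β * ∑ᶠ e ∈ E, chi (σ e.1) * chi (σ (e.1 + edgeDir L e.2)))

def gammaSet (L : AddSubgroup (ℤ × ℤ)) (E10 E01 : Set (TorusV L × Bool)) (i j : Fin 2) :
    Set (TorusV L × Bool) :=
  symmDiff (if i = 1 then E10 else ∅) (if j = 1 then E01 else ∅)

def muPQ (L : AddSubgroup (ℤ × ℤ)) (β : ℝ) (E10 E01 : Set (TorusV L × Bool)) (p q : Fin 2)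
    (σ : TorusV L → Bool) : ℝ :=
  (1 / 4) * ∑ i : Fin 2, ∑ j : Fin 2,
    (-1 : ℝ) ^ ((1 - (p : ℕ)) * (i : ℕ) + (1 - (q : ℕ)) * (j : ℕ) + (i : ℕ) * (j : ℕ)) *
      disorderWeight L β (gammaSet L E10 E01 i j) σ

def meetsAt {L : AddSubgroup (ℤ × ℤ)} {w : ℤ × ℤ} (γ : DualLoop L w) (u : TorusV L) : Prop :=
  ∃ t : ℤ, 0 ≤ t ∧ t < (γ.len : ℤ) ∧ QuotientAddGroup.mk (γ.pos t) = u

def singleIntersection {L : AddSubgroup (ℤ × ℤ)} {w1 w2 : ℤ × ℤ}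
    (γ1 : DualLoop L w1) (γ2 : DualLoop L w2) : Prop :=
  ∃! u : TorusV L, meetsAt γ1 u ∧ meetsAt γ2 u

/-! ## Signs of elements of `ZMod 2` -/

def sg (a : ZMod 2) : ℝ := if a = 0 then 1 else -1

@[simp] lemma sg_zero : sg 0 = 1 := by simp [sg]

@[simp] lemma sg_one : sg 1 = -1 := by simp [sg]

lemma zmod_two_cases (a : ZMod 2) : a = 0 ∨ a = 1 := by
  revert a; decide

lemma sg_add (a b : ZMod 2) : sg (a + b) = sg a * sg b := by
  rcases zmod_two_cases a with rfl | rfl <;> rcases zmod_two_cases b with rfl | rfl <;>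
    simp [CharTwo.add_self_eq_zero]

lemma sg_mul_self (a : ZMod 2) : sg a * sg a = 1 := by
  rw [← sg_add, CharTwo.add_self_eq_zero, sg_zero]

lemma sg_sq (a : ZMod 2) : sg a ^ 2 = 1 := by rw [sq, sg_mul_self]

lemma sg_eq_one_or (a : ZMod 2) : sg a = 1 ∨ sg a = -1 := by
  rcases zmod_two_cases a with rfl | rfl <;> simp

lemma sg_ne_zero (a : ZMod 2) : sg a ≠ 0 := by
  rcases zmod_two_cases a with rfl | rfl <;> simp

/-! ## Functions on the square lattice -/

lemma plane_induction {S : ℤ × ℤ → Prop} (o : ℤ × ℤ) (ho : S o)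
    (h1 : ∀ a, S a ↔ S (a + (1, 0))) (h2 : ∀ a, S a ↔ S (a + (0, 1))) (a : ℤ × ℤ) : S a := by
  have A : ∀ n : ℤ, S (o + (n, 0)) := by
    intro n
    induction n using Int.induction_on with
    | zero => simpa [← Prod.zero_eq_mk] using ho
    | succ k ih =>
      have := (h1 _).1 ih
      simpa [add_assoc] using this
    | pred k ih =>
      refine (h1 _).2 ?_
      simpa [add_assoc] using ih
  have B : ∀ m n : ℤ, S (o + (m, n)) := by
    intro m n
    induction n using Int.induction_on with
    | zero => exact A m
    | succ k ih =>
      have := (h2 _).1 ih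
      simpa [add_assoc] using this
    | pred k ih =>
      refine (h2 _).2 ?_
      simpa [add_assoc] using ih
  have := B (a.1 - o.1) (a.2 - o.2)
  convert this using 1
  ext <;> simp

lemma exists_int_primitive {M : Type*} [AddCommGroup M] (f : ℤ → M) :
    ∃ F : ℤ → M, F 0 = 0 ∧ ∀ n, F (n + 1) = F n + f n := by
  let T : Equiv.Perm (ℤ × M) :=
    { toFun := fun x => (x.1 + 1, x.2 + f x.1)
      invFun := fun x => (x.1 - 1, x.2 - f (x.1 - 1))
      left_inv := fun x => by simp
      right_inv := fun x => by simp }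
  have hT : ∀ x, T x = (x.1 + 1, x.2 + f x.1) := fun _ => rfl
  have hs : ∀ n : ℤ, (T ^ (n + 1)) (0, 0) = T ((T ^ n) (0, 0)) := by
    intro n
    rw [add_comm, zpow_one_add, Equiv.Perm.mul_apply]
  have hf : ∀ n : ℤ, ((T ^ n) (0, 0)).1 = n := by
    intro n
    induction n using Int.induction_on with
    | zero => simp
    | succ k ih => rw [hs, hT]; simp only [ih]
    | pred k ih =>
      have := hs (-(k : ℤ) - 1)
      rw [sub_add_cancel] at this
      rw [this, hT] at ih
      simp only at ih
      linarith
  refine ⟨fun n => ((T ^ n) (0, 0)).2, by simp, fun n => ?_⟩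
  simp only [hs, hT, hf]

lemma exists_plane_primitive {M : Type*} [AddCommGroup M] (f g : ℤ × ℤ → M)
    (h : ∀ a, f a + g (a + (1, 0)) = g a + f (a + (0, 1))) (o : ℤ × ℤ) :
    ∃ F : ℤ × ℤ → M, F o = 0 ∧
      ∀ a, F (a + (1, 0)) = F a + f a ∧ F (a + (0, 1)) = F a + g a := by
  obtain ⟨H, -, hH⟩ := exists_int_primitive fun m => f (m, 0)
  choose K hK0 hK using fun m : ℤ => exists_int_primitive fun n => g (m, n)
  let F₀ : ℤ × ℤ → M := fun a => H a.1 + K a.1 a.2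
  have hv : ∀ m n, F₀ (m, n + 1) = F₀ (m, n) + g (m, n) := by
    intro m n
    simp only [F₀, hK]
    abel
  have hh : ∀ m n, F₀ (m + 1, n) = F₀ (m, n) + f (m, n) := by
    intro m n
    induction n using Int.induction_on with
    | zero => simp [F₀, hK0, hH]
    | succ k ih =>
      have := h (m, (k : ℤ))
      simp only [Prod.mk_add_mk, add_zero] at this
      rw [hv, hv, ih, add_assoc, this]
      abel
    | pred k ih =>
      have := h (m, -(k : ℤ) - 1)
      simp only [Prod.mk_add_mk, add_zero, sub_add_cancel] at this
      have h1 := hv (m + 1) (-(k : ℤ) - 1)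
      have h2 := hv m (-(k : ℤ) - 1)
      rw [sub_add_cancel] at h1 h2
      rw [h1, h2] at ih
      have e : F₀ (m + 1, -(k : ℤ) - 1) + g (m + 1, -(k : ℤ) - 1)
          = F₀ (m, -(k : ℤ) - 1) + f (m, -(k : ℤ) - 1) + g (m + 1, -(k : ℤ) - 1) := by
        rw [ih, add_assoc, ← this, ← add_assoc]
      exact add_right_cancel e
  refine ⟨fun a => F₀ a - F₀ o, by simp, fun a => ?_⟩
  obtain ⟨m, n⟩ := a
  constructor
  · have := hh m n
    simp only [Prod.mk_add_mk, add_zero, this]; abel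
  · have := hv m n
    simp only [Prod.mk_add_mk, add_zero, this]; abel

/-- If the increments of `F` along both axes are invariant under translation by `w`, then so is
the increment of `F` along `w`. -/
lemma plane_increment_const {M : Type*} [AddCommGroup M] {F f g : ℤ × ℤ → M} {w : ℤ × ℤ}
    (hF : ∀ a, F (a + (1, 0)) = F a + f a ∧ F (a + (0, 1)) = F a + g a)
    (hf : ∀ a, f (a + w) = f a) (hg : ∀ a, g (a + w) = g a) (o a : ℤ × ℤ) :
    F (a + w) - F a = F (o + w) - F o := by
  refine plane_induction (S := fun a => F (a + w) - F a = F (o + w) - F o) o rfl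
    (fun a => ?_) (fun a => ?_) a
  · rw [add_right_comm, (hF _).1, (hF _).1, hf, add_sub_add_right_eq_sub]
  · rw [add_right_comm, (hF _).2, (hF _).2, hg, add_sub_add_right_eq_sub]

/-! ## Cochains on the discrete torus

`G` is the group of vertices, `p : ℤ × ℤ →+ G` the projection from the plane, and `G × Bool` the set
of edges, `(x, false)` joining `x` to `x + p (1, 0)` and `(x, true)` joining `x` to `x + p (0, 1)`.
The face `f` has corners `f`, `f + p (1, 0)`, `f + p (0, 1)` and `f + p (1, 1)`. -/

section Cochains

variable {G : Type*} [AddCommGroup G]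

def cob (p : ℤ × ℤ →+ G) : (G → ZMod 2) →ₗ[ZMod 2] (G × Bool → ZMod 2) where
  toFun κ e := κ e.1 + κ (e.1 + if e.2 then p (0, 1) else p (1, 0))
  map_add' κ κ' := by ext e; simp only [Pi.add_apply]; ring
  map_smul' c κ := by ext e; simp only [Pi.smul_apply, smul_eq_mul, RingHom.id_apply]; ring

/-- The sum of an edge cochain along the boundary of each face. -/
def faceSum (p : ℤ × ℤ →+ G) : (G × Bool → ZMod 2) →ₗ[ZMod 2] (G → ZMod 2) where
  toFun P f := P (f, false) + P (f + p (0, 1), false) + P (f, true) + P (f + p (1, 0), true)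
  map_add' P P' := by ext f; simp only [Pi.add_apply]; ring
  map_smul' c P := by ext f; simp only [Pi.smul_apply, smul_eq_mul, RingHom.id_apply]; ring

/-- The boundary of a chain of faces. -/
def faceBd (p : ℤ × ℤ →+ G) : (G → ZMod 2) →ₗ[ZMod 2] (G × Bool → ZMod 2) where
  toFun φ e := φ e.1 + φ (e.1 - if e.2 then p (1, 0) else p (0, 1))
  map_add' κ κ' := by ext e; simp only [Pi.add_apply]; ring
  map_smul' c κ := by ext e; simp only [Pi.smul_apply, smul_eq_mul, RingHom.id_apply]; ring

/-- The boundary of a chain of edges. -/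
def starSum (p : ℤ × ℤ →+ G) : (G × Bool → ZMod 2) →ₗ[ZMod 2] (G → ZMod 2) where
  toFun Q v := Q (v, false) + Q (v - p (1, 0), false) + Q (v, true) + Q (v - p (0, 1), true)
  map_add' P P' := by ext f; simp only [Pi.add_apply]; ring
  map_smul' c P := by ext f; simp only [Pi.smul_apply, smul_eq_mul, RingHom.id_apply]; ring

variable (p : ℤ × ℤ →+ G)

lemma cob_apply_false (κ : G → ZMod 2) (x : G) :
    cob p κ (x, false) = κ x + κ (x + p (1, 0)) := rfl

lemma cob_apply_true (κ : G → ZMod 2) (x : G) :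
    cob p κ (x, true) = κ x + κ (x + p (0, 1)) := rfl

lemma faceBd_apply_false (φ : G → ZMod 2) (x : G) :
    faceBd p φ (x, false) = φ x + φ (x - p (0, 1)) := rfl

lemma faceBd_apply_true (φ : G → ZMod 2) (x : G) :
    faceBd p φ (x, true) = φ x + φ (x - p (1, 0)) := rfl

lemma faceSum_apply (P : G × Bool → ZMod 2) (f : G) :
    faceSum p P f = P (f, false) + P (f + p (0, 1), false) + P (f, true) + P (f + p (1, 0), true) :=
  rfl

lemma starSum_apply (Q : G × Bool → ZMod 2) (v : G) :
    starSum p Q v = Q (v, false) + Q (v - p (1, 0), false) + Q (v, true) + Q (v - p (0, 1), true) :=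
  rfl

lemma faceSum_cob (κ : G → ZMod 2) : faceSum p (cob p κ) = 0 := by
  ext f
  have h2 : (2 : ZMod 2) = 0 := rfl
  simp only [faceSum_apply, cob_apply_false, cob_apply_true, Pi.zero_apply,
    add_right_comm f (p (1, 0)) (p (0, 1))]
  linear_combination (κ f + κ (f + p (1, 0)) + κ (f + p (0, 1)) + κ (f + p (0, 1) + p (1, 0))) * h2

lemma starSum_faceBd (φ : G → ZMod 2) : starSum p (faceBd p φ) = 0 := by
  ext v
  have h2 : (2 : ZMod 2) = 0 := rfl
  simp only [starSum_apply, faceBd_apply_false, faceBd_apply_true, Pi.zero_apply,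
    sub_right_comm v (p (1, 0)) (p (0, 1))]
  linear_combination (φ v + φ (v - p (1, 0)) + φ (v - p (0, 1)) + φ (v - p (0, 1) - p (1, 0))) * h2

section Single

variable [DecidableEq G]

/-- The indicator of an edge. -/
abbrev edge (x : G) (b : Bool) : G × Bool → ZMod 2 := Pi.single (x, b) 1

lemma cob_single (v : G) : cob p (Pi.single v 1) =
    edge v false + edge v true + edge (v - p (1, 0)) false + edge (v - p (0, 1)) true := by
  ext ⟨x, b⟩
  cases b <;>
  simp [cob_apply_false, cob_apply_true, Pi.single_apply, eq_sub_iff_add_eq]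

lemma faceBd_single (f : G) : faceBd p (Pi.single f 1) =
    edge f false + edge (f + p (1, 0)) true + edge (f + p (0, 1)) false + edge f true := by
  ext ⟨x, b⟩
  cases b <;>
  simp [faceBd_apply_false, faceBd_apply_true, Pi.single_apply, sub_eq_iff_eq_add, add_comm]

lemma faceSum_edge_true (x : G) :
    faceSum p (edge x true) = Pi.single x 1 + Pi.single (x - p (1, 0)) 1 := by
  ext f
  simp [faceSum_apply, Pi.single_apply, eq_sub_iff_add_eq]

lemma faceSum_edge_false (x : G) :
    faceSum p (edge x false) = Pi.single x 1 + Pi.single (x - p (0, 1)) 1 := by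
  ext f
  simp [faceSum_apply, Pi.single_apply, eq_sub_iff_add_eq]

lemma starSum_edge_true (x : G) :
    starSum p (edge x true) = Pi.single x 1 + Pi.single (x + p (0, 1)) 1 := by
  ext f
  simp [starSum_apply, Pi.single_apply, sub_eq_iff_eq_add]

lemma starSum_edge_false (x : G) :
    starSum p (edge x false) = Pi.single x 1 + Pi.single (x + p (1, 0)) 1 := by
  ext f
  simp [starSum_apply, Pi.single_apply, sub_eq_iff_eq_add]

end Single

open scoped Matrix

variable [Fintype G]

lemma dot_cob (Q : G × Bool → ZMod 2) (κ : G → ZMod 2) :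
    Q ⬝ᵥ cob p κ = starSum p Q ⬝ᵥ κ := by
  have h (b : Bool) (c : G) : ∑ x, Q (x, b) * κ (x + c) = ∑ x, Q (x - c, b) * κ x :=
    Fintype.sum_equiv (Equiv.addRight c) _ _ fun x => by simp
  simp only [dotProduct, Fintype.sum_prod_type, Fintype.sum_bool, cob_apply_false,
    cob_apply_true, starSum_apply, mul_add, add_mul, Finset.sum_add_distrib, h]
  ring

lemma faceBd_dot (φ : G → ZMod 2) (P : G × Bool → ZMod 2) :
    faceBd p φ ⬝ᵥ P = φ ⬝ᵥ faceSum p P := by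
  have h (b : Bool) (c : G) : ∑ x, φ (x - c) * P (x, b) = ∑ x, φ x * P (x + c, b) :=
    (Fintype.sum_equiv (Equiv.addRight c) _ _ fun x => by simp).symm
  simp only [dotProduct, Fintype.sum_prod_type, Fintype.sum_bool, faceBd_apply_false,
    faceBd_apply_true, faceSum_apply, mul_add, add_mul, Finset.sum_add_distrib, h]
  ring

/-- Summing all characters of the group of edge cochains. -/
lemma sum_sg_dot {ι : Type*} [Fintype ι] [DecidableEq ι] (A : ι → ZMod 2) :
    ∑ Q : ι → ZMod 2, sg (Q ⬝ᵥ A) = if A = 0 then (Fintype.card (ι → ZMod 2) : ℝ) else 0 := by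
  split_ifs with h
  · simp [h]
  · obtain ⟨e, he⟩ := Function.ne_iff.1 h
    have he : A e = 1 := (zmod_two_cases _).resolve_left he
    have : ∑ Q : ι → ZMod 2, sg (Q ⬝ᵥ A) = ∑ Q : ι → ZMod 2, - sg (Q ⬝ᵥ A) :=
      (Fintype.sum_equiv (Equiv.addRight (Pi.single e 1)) _ _ fun Q => by
        simp [add_dotProduct, sg_add, he]).symm
    rw [Finset.sum_neg_distrib] at this
    linarith

/-! ## Critical weights and twisted correlations -/

/-- The critical Boltzmann weight of a configuration of frustrated edges. -/
def wt {ι : Type*} [Fintype ι] (A : ι → ZMod 2) : ℝ := Real.exp (betaC * ∑ e, sg (A e))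

lemma wt_pos {ι : Type*} [Fintype ι] (A : ι → ZMod 2) : 0 < wt A := Real.exp_pos _

lemma exp_two_betaC : Real.exp (2 * betaC) = √2 + 1 := by
  rw [betaC, mul_div_cancel₀ _ two_ne_zero, Real.exp_log (by positivity)]

lemma exp_neg_two_betaC : Real.exp (-(2 * betaC)) = √2 - 1 := by
  rw [Real.exp_neg, exp_two_betaC]
  refine inv_eq_of_mul_eq_one_right ?_
  nlinarith [Real.mul_self_sqrt (show (0 : ℝ) ≤ 2 by norm_num)]

lemma wt_add_single {ι : Type*} [Fintype ι] [DecidableEq ι] (A : ι → ZMod 2) (e : ι) :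
    wt (A + Pi.single e 1) = wt A * (√2 - sg (A e)) := by
  have h : ∑ e', sg ((A + Pi.single e 1 : ι → ZMod 2) e') = ∑ e', sg (A e') - 2 * sg (A e) := by
    rw [← Finset.add_sum_erase _ _ (Finset.mem_univ e),
      ← Finset.add_sum_erase _ _ (Finset.mem_univ e)]
    have h' : ∀ e' ∈ Finset.univ.erase e,
        sg ((A + Pi.single e 1 : ι → ZMod 2) e') = sg (A e') := fun e' he' => by
      simp [Finset.ne_of_mem_erase he']
    rw [Finset.sum_congr rfl h']
    simp [sg_add]
    ring
  rw [wt, h, mul_sub, sub_eq_add_neg, Real.exp_add, ← wt]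
  congr 1
  rcases zmod_two_cases (A e) with h | h
  · rw [h, sg_zero, ← exp_neg_two_betaC]; ring_nf
  · rw [h, sg_one, sub_neg_eq_add, ← exp_two_betaC]; ring_nf

variable [DecidableEq G]

/-- The correlation of the spins in `V`, with an additional insertion of the product of the signs
of the edges in `Q` and with the signs of the couplings changed along `P`, summed over the four spin
structures with the signs determined by `a`, `b`. -/
def corr (α β : G × Bool → ZMod 2) (V : G → ZMod 2) (a b : ZMod 2)
    (P Q : G × Bool → ZMod 2) : ℝ :=
  ∑ i : ZMod 2, ∑ j : ZMod 2, ∑ σ : G → ZMod 2,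
    sg (a * i + b * j + i * j + V ⬝ᵥ σ + Q ⬝ᵥ (cob p σ + P + i • α + j • β)) *
      wt (cob p σ + P + i • α + j • β)

variable {p} {α β : G × Bool → ZMod 2} {V : G → ZMod 2} {a b : ZMod 2}
  {P Q : G × Bool → ZMod 2}

lemma corr_add_cob (κ : G → ZMod 2) :
    corr p α β V a b (P + cob p κ) Q = sg (V ⬝ᵥ κ) * corr p α β V a b P Q := by
  simp only [corr, Finset.mul_sum]
  refine Finset.sum_congr rfl fun i _ => Finset.sum_congr rfl fun j _ => ?_
  refine Fintype.sum_equiv (Equiv.addRight κ) _ _ fun σ => ?_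
  have h : cob p (σ + κ) + P = cob p σ + (P + cob p κ) := by rw [map_add]; abel
  simp only [Equiv.coe_addRight, h, dotProduct_add V, sg_add]
  linear_combination (-(sg (a * i) * sg (b * j) * sg (i * j) * sg (V ⬝ᵥ σ) *
    sg (Q ⬝ᵥ (cob p σ + (P + cob p κ) + i • α + j • β)) *
      wt (cob p σ + (P + cob p κ) + i • α + j • β))) * sg_mul_self (V ⬝ᵥ κ)

lemma corr_add_single (e : G × Bool) :
    corr p α β V a b (P + Pi.single e 1) Q = sg (Q e) *
      (√2 * corr p α β V a b P Q - corr p α β V a b P (Q + Pi.single e 1)) := by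
  simp only [corr, Finset.mul_sum, ← Finset.sum_sub_distrib]
  refine Finset.sum_congr rfl fun i _ => Finset.sum_congr rfl fun j _ =>
    Finset.sum_congr rfl fun σ _ => ?_
  have h : cob p σ + (P + Pi.single e 1) + i • α + j • β =
    (cob p σ + P + i • α + j • β) + Pi.single e 1 := by abel
  rw [h, wt_add_single, dotProduct_add, add_dotProduct]
  simp only [sg_add, dotProduct_single, mul_one, single_dotProduct, one_mul]
  ring

lemma corr_add_cycle {R : G × Bool → ZMod 2} (hR : starSum p R = 0) (hα : R ⬝ᵥ α = 0)
    (hβ : R ⬝ᵥ β = 0) :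
    corr p α β V a b P (Q + R) = sg (R ⬝ᵥ P) * corr p α β V a b P Q := by
  simp only [corr, Finset.mul_sum]
  refine Finset.sum_congr rfl fun i _ => Finset.sum_congr rfl fun j _ =>
    Finset.sum_congr rfl fun σ _ => ?_
  rw [add_dotProduct Q R]
  simp only [dotProduct_add R, dotProduct_smul, hα, hβ, dot_cob, hR, zero_dotProduct, sg_add,
    smul_zero, sg_zero]
  ring

lemma corr_add_faceBd (hα : faceSum p α = 0) (hβ : faceSum p β = 0) (φ : G → ZMod 2) :
    corr p α β V a b P (Q + faceBd p φ) = sg (φ ⬝ᵥ faceSum p P) * corr p α β V a b P Q := by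
  rw [corr_add_cycle (starSum_faceBd p φ) (by simp [faceBd_dot, hα]) (by simp [faceBd_dot, hβ]),
    faceBd_dot]

lemma corr_translate_left {R : G × Bool → ZMod 2} (hR : starSum p R = 0) (hα : R ⬝ᵥ α = 0)
    (hβ : R ⬝ᵥ β = 1) :
    corr p α β V a b (P + α) (Q + R) = sg (a + R ⬝ᵥ P) * corr p α β V a b P Q := by
  simp only [corr, Finset.mul_sum]
  refine Fintype.sum_equiv (Equiv.addRight 1) _ _ fun i => ?_
  refine Finset.sum_congr rfl fun j _ => Finset.sum_congr rfl fun σ _ => ?_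
  have h : cob p σ + (P + α) + i • α + j • β = cob p σ + P + (i + 1) • α + j • β := by
    rw [add_smul, one_smul]; abel
  have e1 : (i + 1) * j = i * j + j := by ring
  have e2 : a * (i + 1) = a * i + a := by ring
  rw [h, add_dotProduct Q R]
  simp only [Equiv.coe_addRight, e1, e2, dotProduct_add R, dotProduct_smul, hα, hβ, dot_cob, hR,
    zero_dotProduct, sg_add, smul_eq_mul, mul_one, mul_zero, sg_zero]
  rcases sg_eq_one_or a with ha | ha <;> rw [ha] <;> ring

lemma corr_translate_right {R : G × Bool → ZMod 2} (hR : starSum p R = 0) (hα : R ⬝ᵥ α = 1)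
    (hβ : R ⬝ᵥ β = 0) :
    corr p α β V a b (P + β) (Q + R) = sg (b + R ⬝ᵥ P) * corr p α β V a b P Q := by
  simp only [corr, Finset.mul_sum]
  refine Finset.sum_congr rfl fun i _ => ?_
  refine Fintype.sum_equiv (Equiv.addRight 1) _ _ fun j => ?_
  refine Finset.sum_congr rfl fun σ _ => ?_
  have h : cob p σ + (P + β) + i • α + j • β = cob p σ + P + i • α + (j + 1) • β := by
    rw [add_smul, one_smul]; abel
  have e1 : i * (j + 1) = i * j + i := by ring
  have e2 : b * (j + 1) = b * j + b := by ring
  rw [h, add_dotProduct Q R]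
  simp only [Equiv.coe_addRight, e1, e2, dotProduct_add R, dotProduct_smul, hα, hβ, dot_cob, hR,
    zero_dotProduct, sg_add, smul_eq_mul, mul_one, mul_zero, sg_zero]
  rcases sg_eq_one_or b with hb | hb <;> rw [hb] <;> ring

end Cochains

section Planar

open scoped Matrix

variable {G : Type*} [AddCommGroup G] [DecidableEq G]

/-- `α` and `β` are closed edge cochains on the quotient torus which are dual to loops lifting to
paths from `a` to `a + w1` and from `a` to `a + w2`, respectively: they detect the homology classes
of the periods, and adding them to a cochain moves a flux through a period. -/
structure IsDualPair (p : ℤ × ℤ →+ G) (w1 w2 : ℤ × ℤ) (α β : G × Bool → ZMod 2) : Prop where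
  surjective : Function.Surjective p
  mem_closure : ∀ a, p a = 0 → a ∈ AddSubgroup.closure {w1, w2}
  map_left : p w1 = 0
  map_right : p w2 = 0
  faceSum_left : faceSum p α = 0
  faceSum_right : faceSum p β = 0
  class_add : ∀ pc : ℤ × ℤ → (G × Bool → ZMod 2) ⧸ LinearMap.range (cob p),
    (∀ a, pc (a + (1, 0)) = pc a + Submodule.Quotient.mk (edge (p (a + (1, 0))) true) ∧
      pc (a + (0, 1)) = pc a + Submodule.Quotient.mk (edge (p (a + (0, 1))) false)) →
    ∀ a, pc (a + w1) = pc a + Submodule.Quotient.mk α ∧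
      pc (a + w2) = pc a + Submodule.Quotient.mk β
  potential_left : ∀ h : ℤ × ℤ → ZMod 2,
    (∀ a, h (a + (1, 0)) = h a + α (p a, false) ∧ h (a + (0, 1)) = h a + α (p a, true)) →
    ∀ a, h (a + w1) = h a ∧ h (a + w2) = h a + 1
  potential_right : ∀ h : ℤ × ℤ → ZMod 2,
    (∀ a, h (a + (1, 0)) = h a + β (p a, false) ∧ h (a + (0, 1)) = h a + β (p a, true)) →
    ∀ a, h (a + w1) = h a + 1 ∧ h (a + w2) = h a

/-- The classes of disorder lines (up to coboundaries) and of spin lines (up to face boundaries)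
along paths in the plane starting at `o`. -/
structure IsLinePair (p : ℤ × ℤ →+ G) (o : ℤ × ℤ)
    (pc : ℤ × ℤ → (G × Bool → ZMod 2) ⧸ LinearMap.range (cob p))
    (qc : ℤ × ℤ → (G × Bool → ZMod 2) ⧸ LinearMap.range (faceBd p)) : Prop where
  pc_base : pc o = 0
  qc_base : qc o = 0
  pc_step : ∀ a, pc (a + (1, 0)) = pc a + Submodule.Quotient.mk (edge (p (a + (1, 0))) true) ∧
    pc (a + (0, 1)) = pc a + Submodule.Quotient.mk (edge (p (a + (0, 1))) false)
  qc_step : ∀ a, qc (a + (1, 0)) = qc a + Submodule.Quotient.mk (edge (p a) false) ∧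
    qc (a + (0, 1)) = qc a + Submodule.Quotient.mk (edge (p a) true)

lemma exists_isLinePair (p : ℤ × ℤ →+ G) (o : ℤ × ℤ) : ∃ pc qc, IsLinePair p o pc qc := by
  have h2 (x : G × Bool → ZMod 2) : x + x = 0 := by ext; exact CharTwo.add_self_eq_zero _
  obtain ⟨pc, h0, h1⟩ := exists_plane_primitive
    (fun a => (Submodule.Quotient.mk (edge (p (a + (1, 0))) true) :
      (G × Bool → ZMod 2) ⧸ LinearMap.range (cob p)))
    (fun a => Submodule.Quotient.mk (edge (p (a + (0, 1))) false)) (fun a => by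
      simp only [← Submodule.Quotient.mk_add]
      rw [Submodule.Quotient.eq]
      refine ⟨Pi.single (p (a + (1, 0) + (0, 1))) 1, ?_⟩
      rw [cob_single, ← map_sub, ← map_sub, add_sub_cancel_right, add_right_comm a (0, 1) (1, 0),
        show a + (1, 0) + (0, 1) - (1, 0) = a + (0, 1) by abel, eq_sub_iff_add_eq]
      linear_combination (exp := 1) h2 (edge (p (a + (0, 1))) false) +
        h2 (edge (p (a + (1, 0) + (0, 1))) true)) o
  obtain ⟨qc, g0, g1⟩ := exists_plane_primitive
    (fun a => (Submodule.Quotient.mk (edge (p a) false) :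
      (G × Bool → ZMod 2) ⧸ LinearMap.range (faceBd p)))
    (fun a => Submodule.Quotient.mk (edge (p a) true)) (fun a => by
      simp only [← Submodule.Quotient.mk_add]
      rw [Submodule.Quotient.eq]
      refine ⟨Pi.single (p a) 1, ?_⟩
      rw [faceBd_single, ← map_add, ← map_add, eq_sub_iff_add_eq]
      linear_combination (exp := 1) h2 (edge (p a) true) +
        h2 (edge (p (a + (0, 1))) false)) o
  exact ⟨pc, qc, h0, g0, h1, g1⟩

variable {p : ℤ × ℤ →+ G} {w1 w2 o : ℤ × ℤ} {α β : G × Bool → ZMod 2}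
  {pc : ℤ × ℤ → (G × Bool → ZMod 2) ⧸ LinearMap.range (cob p)}
  {qc : ℤ × ℤ → (G × Bool → ZMod 2) ⧸ LinearMap.range (faceBd p)}

lemma IsLinePair.faceSum_eq (h : IsLinePair p o pc qc) (a : ℤ × ℤ) {P : G × Bool → ZMod 2}
    (hP : Submodule.Quotient.mk P = pc a) :
    faceSum p P = Pi.single (p a) 1 + Pi.single (p o) 1 := by
  have h2 (x : G → ZMod 2) : x + x = 0 := by ext; exact CharTwo.add_self_eq_zero _
  let T := (LinearMap.range (cob p)).liftQ (faceSum p) <| by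
    rintro _ ⟨κ, rfl⟩
    exact faceSum_cob p κ
  have hT (P : G × Bool → ZMod 2) : T (Submodule.Quotient.mk P) = faceSum p P :=
    Submodule.liftQ_apply _ _ _
  rw [← hT, hP]
  refine plane_induction (S := fun a => T (pc a) = Pi.single (p a) 1 + Pi.single (p o) 1) o ?_
    (fun a => ?_) (fun a => ?_) a
  · rw [h.pc_base, map_zero, h2]
  · rw [(h.pc_step a).1, map_add, hT, faceSum_edge_true, map_add p a, add_sub_cancel_right]
    constructor <;> intro h'
    · linear_combination (exp := 1) h' + h2 (Pi.single (p a) 1)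
    · linear_combination (exp := 1) h' - h2 (Pi.single (p a) 1)
  · rw [(h.pc_step a).2, map_add, hT, faceSum_edge_false, map_add p a, add_sub_cancel_right]
    constructor <;> intro h'
    · linear_combination (exp := 1) h' + h2 (Pi.single (p a) 1)
    · linear_combination (exp := 1) h' - h2 (Pi.single (p a) 1)

lemma IsLinePair.starSum_eq (h : IsLinePair p o pc qc) (a : ℤ × ℤ) {Q : G × Bool → ZMod 2}
    (hQ : Submodule.Quotient.mk Q = qc a) :
    starSum p Q = Pi.single (p a) 1 + Pi.single (p o) 1 := by
  have h2 (x : G → ZMod 2) : x + x = 0 := by ext; exact CharTwo.add_self_eq_zero _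
  let T := (LinearMap.range (faceBd p)).liftQ (starSum p) <| by
    rintro _ ⟨φ, rfl⟩
    exact starSum_faceBd p φ
  have hT (P : G × Bool → ZMod 2) : T (Submodule.Quotient.mk P) = starSum p P :=
    Submodule.liftQ_apply _ _ _
  rw [← hT, hQ]
  refine plane_induction (S := fun a => T (qc a) = Pi.single (p a) 1 + Pi.single (p o) 1) o ?_
    (fun a => ?_) (fun a => ?_) a
  · rw [h.qc_base, map_zero, h2]
  · rw [(h.qc_step a).1, map_add, hT, starSum_edge_false, map_add p a]
    constructor <;> intro h'
    · linear_combination (exp := 1) h' + h2 (Pi.single (p a) 1)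
    · linear_combination (exp := 1) h' - h2 (Pi.single (p a) 1)
  · rw [(h.qc_step a).2, map_add, hT, starSum_edge_true, map_add p a]
    constructor <;> intro h'
    · linear_combination (exp := 1) h' + h2 (Pi.single (p a) 1)
    · linear_combination (exp := 1) h' - h2 (Pi.single (p a) 1)

variable [Fintype G]

/-- The pairing of spin lines with a closed edge cochain is a potential of this cochain. -/
lemma IsLinePair.exists_potential (h : IsLinePair p o pc qc) (hα : faceSum p α = 0) :
    ∃ u : ℤ × ℤ → ZMod 2,
      (∀ a, u (a + (1, 0)) = u a + α (p a, false) ∧ u (a + (0, 1)) = u a + α (p a, true)) ∧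
      ∀ a Q, Submodule.Quotient.mk Q = qc a → Q ⬝ᵥ α = u a := by
  let D : (G × Bool → ZMod 2) →ₗ[ZMod 2] ZMod 2 :=
    { toFun := fun Q => Q ⬝ᵥ α
      map_add' := fun Q Q' => add_dotProduct Q Q' α
      map_smul' := fun c Q => smul_dotProduct c Q α }
  let T := (LinearMap.range (faceBd p)).liftQ D <| by
    rintro _ ⟨φ, rfl⟩
    change faceBd p φ ⬝ᵥ α = 0
    rw [faceBd_dot, hα, dotProduct_zero]
  have hT (Q : G × Bool → ZMod 2) : T (Submodule.Quotient.mk Q) = Q ⬝ᵥ α :=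
    Submodule.liftQ_apply _ _ _
  refine ⟨fun a => T (qc a), fun a => ?_, fun a Q hQ => by simp only [← hQ, hT]⟩
  simp only [(h.qc_step a).1, (h.qc_step a).2, map_add, hT, single_dotProduct, one_mul, and_self]

/-- The square of the correlation only depends on the classes of the disorder and spin lines. -/
def corrSq (α β : G × Bool → ZMod 2) (V : G → ZMod 2) (c d : ZMod 2)
    (x : (G × Bool → ZMod 2) ⧸ LinearMap.range (cob p))
    (y : (G × Bool → ZMod 2) ⧸ LinearMap.range (faceBd p)) : ℝ :=
  corr p α β V c d (Function.surjInv (Submodule.Quotient.mk_surjective _) x)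
    (Function.surjInv (Submodule.Quotient.mk_surjective _) y) ^ 2

variable {V : G → ZMod 2} {c d : ZMod 2}

lemma corrSq_mk (hα : faceSum p α = 0) (hβ : faceSum p β = 0) (P Q : G × Bool → ZMod 2) :
    corrSq α β V c d (Submodule.Quotient.mk P : _ ⧸ LinearMap.range (cob p))
      (Submodule.Quotient.mk Q : _ ⧸ LinearMap.range (faceBd p)) = corr p α β V c d P Q ^ 2 := by
  rw [corrSq]
  set P' := Function.surjInv (Submodule.Quotient.mk_surjective (LinearMap.range (cob p)))
    (Submodule.Quotient.mk P) with hP'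
  set Q' := Function.surjInv (Submodule.Quotient.mk_surjective (LinearMap.range (faceBd p)))
    (Submodule.Quotient.mk Q) with hQ'
  obtain ⟨κ, hκ⟩ := (Submodule.Quotient.eq _).1
    (Function.surjInv_eq (Submodule.Quotient.mk_surjective (LinearMap.range (cob p)))
      (Submodule.Quotient.mk P))
  obtain ⟨φ, hφ⟩ := (Submodule.Quotient.eq _).1
    (Function.surjInv_eq (Submodule.Quotient.mk_surjective (LinearMap.range (faceBd p)))
      (Submodule.Quotient.mk Q))
  rw [← hP'] at hκ
  rw [← hQ'] at hφ
  rw [← add_sub_cancel P P', ← add_sub_cancel Q Q', ← hκ, ← hφ, corr_add_cob,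
    corr_add_faceBd hα hβ, mul_pow, mul_pow, sg_sq, sg_sq, one_mul, one_mul]

lemma corrSq_translate (D : IsDualPair p w1 w2 α β) (h : IsLinePair p o pc qc) {l : ℤ × ℤ}
    (hl : p l = 0) (a b : ℤ × ℤ) :
    corrSq α β V c d (pc (a + l)) (qc (b + l)) = corrSq α β V c d (pc a) (qc b) := by
  obtain ⟨uα, huα, huα'⟩ := h.exists_potential D.faceSum_left
  obtain ⟨uβ, huβ, huβ'⟩ := h.exists_potential D.faceSum_right
  have key (w : ℤ × ℤ) (hw : p w = 0) (b : ℤ × ℤ) : ∃ Q R : G × Bool → ZMod 2,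
      Submodule.Quotient.mk Q = qc b ∧ Submodule.Quotient.mk (Q + R) = qc (b + w) ∧
      starSum p R = 0 ∧ R ⬝ᵥ α = uα (b + w) - uα b ∧ R ⬝ᵥ β = uβ (b + w) - uβ b := by
    obtain ⟨Q, hQ⟩ := Submodule.Quotient.mk_surjective _ (qc b)
    obtain ⟨Q', hQ'⟩ := Submodule.Quotient.mk_surjective _ (qc (b + w))
    refine ⟨Q, Q' - Q, hQ, by rw [add_sub_cancel, hQ'], ?_, ?_, ?_⟩
    · rw [map_sub, h.starSum_eq _ hQ, h.starSum_eq _ hQ', map_add, hw, add_zero, sub_self]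
    · rw [sub_dotProduct, huα' _ _ hQ, huα' _ _ hQ']
    · rw [sub_dotProduct, huβ' _ _ hQ, huβ' _ _ hQ']
  suffices H : ∀ a b, corrSq α β V c d (pc (a + l)) (qc (b + l)) =
      corrSq α β V c d (pc a) (qc b) from H a b
  have hl' := D.mem_closure l hl
  clear hl
  induction hl' using AddSubgroup.closure_induction with
  | mem w hw =>
    intro a b
    obtain ⟨P, hP⟩ := Submodule.Quotient.mk_surjective _ (pc a)
    rcases hw with rfl | rfl
    · obtain ⟨Q, R, hQ, hQR, hR, hRα, hRβ⟩ := key w D.map_left b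
      rw [(D.class_add pc h.pc_step a).1, ← hQR, ← hQ, ← hP, ← Submodule.Quotient.mk_add,
        corrSq_mk D.faceSum_left D.faceSum_right, corrSq_mk D.faceSum_left D.faceSum_right,
        corr_translate_left hR, mul_pow, sg_sq, one_mul]
      · rw [hRα, (D.potential_left uα huα b).1, sub_self]
      · rw [hRβ, (D.potential_right uβ huβ b).1, add_sub_cancel_left]
    · obtain ⟨Q, R, hQ, hQR, hR, hRα, hRβ⟩ := key w D.map_right b
      rw [(D.class_add pc h.pc_step a).2, ← hQR, ← hQ, ← hP, ← Submodule.Quotient.mk_add,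
        corrSq_mk D.faceSum_left D.faceSum_right, corrSq_mk D.faceSum_left D.faceSum_right,
        corr_translate_right hR, mul_pow, sg_sq, one_mul]
      · rw [hRα, (D.potential_left uα huα b).2, add_sub_cancel_left]
      · rw [hRβ, (D.potential_right uβ huβ b).2, sub_self]
  | zero => simp
  | add x y _ _ hx hy =>
    intro a b
    rw [← add_assoc, ← add_assoc, hy, hx]
  | neg x _ hx =>
    intro a b
    rw [← hx, neg_add_cancel_right, neg_add_cancel_right]

end Planar

section Vanishing

open scoped Matrix

variable {G : Type*} [AddCommGroup G] [DecidableEq G]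
  {p : ℤ × ℤ →+ G} {w1 w2 o : ℤ × ℤ} {α β : G × Bool → ZMod 2}
  {pc : ℤ × ℤ → (G × Bool → ZMod 2) ⧸ LinearMap.range (cob p)}
  {qc : ℤ × ℤ → (G × Bool → ZMod 2) ⧸ LinearMap.range (faceBd p)}
  {V : G → ZMod 2} {c d : ZMod 2} {P Q : G × Bool → ZMod 2}

lemma cochain_add_self {ι : Type*} (x : ι → ZMod 2) : x + x = 0 := by
  ext
  exact CharTwo.add_self_eq_zero _

lemma faceBd_single_map (a : ℤ × ℤ) : faceBd p (Pi.single (p a) 1) = edge (p a) false +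
    edge (p (a + (1, 0))) true + edge (p (a + (0, 1))) false + edge (p a) true := by
  rw [faceBd_single, map_add, map_add]

lemma IsLinePair.qc_diag (h : IsLinePair p o pc qc) {a : ℤ × ℤ}
    (hQ : Submodule.Quotient.mk Q = qc a) :
    Submodule.Quotient.mk (Q + edge (p a) false) = qc (a + (1, 0)) ∧
    Submodule.Quotient.mk (Q + edge (p a) false + edge (p (a + (1, 0))) true) =
      qc (a + (1, 0) + (0, 1)) ∧
    Submodule.Quotient.mk (Q + edge (p a) false + edge (p (a + (1, 0))) true +
      edge (p (a + (0, 1))) false) = qc (a + (0, 1)) := by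
  have h1 : Submodule.Quotient.mk (Q + edge (p a) false) = qc (a + (1, 0)) := by
    rw [Submodule.Quotient.mk_add, hQ, (h.qc_step a).1]
  refine ⟨h1, by rw [Submodule.Quotient.mk_add, h1, (h.qc_step _).2], ?_⟩
  rw [(h.qc_step a).2, ← hQ, ← Submodule.Quotient.mk_add, Submodule.Quotient.eq]
  refine ⟨Pi.single (p a) 1, ?_⟩
  rw [faceBd_single_map]
  linear_combination (exp := 1) cochain_add_self (edge (p a) true)

variable [Fintype G]

lemma corr_add_edge_add_edge (e : G × Bool) :
    corr p α β V c d (P + Pi.single e 1) (Q + Pi.single e 1) = - sg (Q e) *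
      (√2 * corr p α β V c d P (Q + Pi.single e 1) - corr p α β V c d P Q) := by
  rw [corr_add_single, add_assoc, cochain_add_self, add_zero]
  simp [sg_add]

/-- Crossing an edge with the disorder line. -/
lemma corr_sq_add_edge (e : G × Bool) :
    corr p α β V c d (P + Pi.single e 1) Q ^ 2 +
      corr p α β V c d (P + Pi.single e 1) (Q + Pi.single e 1) ^ 2 =
    3 * corr p α β V c d P Q ^ 2 + 3 * corr p α β V c d P (Q + Pi.single e 1) ^ 2 -
      4 * √2 * (corr p α β V c d P Q * corr p α β V c d P (Q + Pi.single e 1)) := by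
  have h2 : √2 * √2 = 2 := Real.mul_self_sqrt (by norm_num)
  rw [corr_add_edge_add_edge, corr_add_single, mul_pow, mul_pow, neg_sq, sg_sq]
  linear_combination (corr p α β V c d P Q ^ 2 +
    corr p α β V c d P (Q + Pi.single e 1) ^ 2) * h2

lemma corr_add_face (D : IsDualPair p w1 w2 α β) (h : IsLinePair p o pc qc) {a : ℤ × ℤ}
    (hP : Submodule.Quotient.mk P = pc a) (hao : p a ≠ p o) :
    corr p α β V c d P (Q + faceBd p (Pi.single (p a) 1)) = - corr p α β V c d P Q := by
  rw [corr_add_faceBd D.faceSum_left D.faceSum_right, single_dotProduct, h.faceSum_eq a hP]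
  simp [hao]

lemma corr_add_face_base (D : IsDualPair p w1 w2 α β) (h : IsLinePair p o pc qc) {a : ℤ × ℤ}
    (hP : Submodule.Quotient.mk P = pc a) (hao : p a = p o) :
    corr p α β V c d P (Q + faceBd p (Pi.single (p a) 1)) = corr p α β V c d P Q := by
  rw [corr_add_faceBd D.faceSum_left D.faceSum_right, single_dotProduct, h.faceSum_eq a hP]
  simp [hao, CharTwo.add_self_eq_zero]

lemma corrSq_eq (D : IsDualPair p w1 w2 α β)
    {x : (G × Bool → ZMod 2) ⧸ LinearMap.range (cob p)}
    {y : (G × Bool → ZMod 2) ⧸ LinearMap.range (faceBd p)}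
    (hP : Submodule.Quotient.mk P = x) (hQ : Submodule.Quotient.mk Q = y) :
    corrSq α β V c d x y = corr p α β V c d P Q ^ 2 := by
  rw [← hP, ← hQ, corrSq_mk D.faceSum_left D.faceSum_right]

lemma corr_eq_zero_of_base (D : IsDualPair p w1 w2 α β) (h : IsLinePair p o pc qc)
    (hz : corr p α β V c d 0 0 = 0) {a : ℤ × ℤ} (hP : Submodule.Quotient.mk P = pc a)
    (hQ : Submodule.Quotient.mk Q = qc a) (hao : p a = p o) :
    corr p α β V c d P Q = 0 := by
  rw [← sq_eq_zero_iff, ← corrSq_eq D hP hQ, ← add_sub_cancel o a,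
    corrSq_translate D h (by rw [map_sub, hao, sub_self]), h.pc_base, h.qc_base,
    corrSq_eq D (Submodule.Quotient.mk_zero _) (Submodule.Quotient.mk_zero _), hz, sq, mul_zero]

/-- The sum of the squared correlations at the neighbours of a face minus the sum at this face. -/
lemma corrSq_defect (D : IsDualPair p w1 w2 α β) (h : IsLinePair p o pc qc)
    (hz : corr p α β V c d 0 0 = 0) {a : ℤ × ℤ} (hP : Submodule.Quotient.mk P = pc a)
    (hQ : Submodule.Quotient.mk Q = qc a) {x0 x1 x2 x3 : ℝ} (h0 : x0 = corr p α β V c d P Q)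
    (h1 : x1 = corr p α β V c d P (Q + edge (p a) false))
    (h2 : x2 = corr p α β V c d P (Q + edge (p a) false + edge (p (a + (1, 0))) true))
    (h3 : x3 = corr p α β V c d P (Q + edge (p a) false + edge (p (a + (1, 0))) true +
      edge (p (a + (0, 1))) false)) :
    (corrSq α β V c d (pc (a - (0, 1))) (qc a) +
        corrSq α β V c d (pc (a - (0, 1))) (qc (a + (1, 0)))) +
      (corrSq α β V c d (pc (a + (1, 0))) (qc (a + (1, 0))) +
        corrSq α β V c d (pc (a + (1, 0))) (qc (a + (1, 0) + (0, 1)))) +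
      (corrSq α β V c d (pc (a + (0, 1))) (qc (a + (1, 0) + (0, 1))) +
        corrSq α β V c d (pc (a + (0, 1))) (qc (a + (0, 1)))) +
      (corrSq α β V c d (pc (a - (1, 0))) (qc (a + (0, 1))) +
        corrSq α β V c d (pc (a - (1, 0))) (qc a)) -
      2 * (corrSq α β V c d (pc a) (qc a) + corrSq α β V c d (pc a) (qc (a + (1, 0))) +
        corrSq α β V c d (pc a) (qc (a + (1, 0) + (0, 1))) +
        corrSq α β V c d (pc a) (qc (a + (0, 1)))) =
    (x1 - x3 - √2 * x0) ^ 2 + (x0 + x2 - √2 * x1) ^ 2 + (x1 + x3 - √2 * x2) ^ 2 +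
      (x2 - x0 - √2 * x3) ^ 2 := by
  obtain ⟨hQ1, hQ2, hQ3⟩ := h.qc_diag hQ
  have hQ3' : Submodule.Quotient.mk (Q + edge (p a) true) = qc (a + (0, 1)) := by
    rw [Submodule.Quotient.mk_add, hQ, (h.qc_step a).2]
  have hPd : Submodule.Quotient.mk (P + edge (p a) false) = pc (a - (0, 1)) := by
    have := (h.pc_step (a - (0, 1))).2
    rw [sub_add_cancel, ← hP, ← sub_eq_iff_eq_add, ← Submodule.Quotient.mk_sub] at this
    rw [← this, CharTwo.sub_eq_add]
  have hPl : Submodule.Quotient.mk (P + edge (p a) true) = pc (a - (1, 0)) := by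
    have := (h.pc_step (a - (1, 0))).1
    rw [sub_add_cancel, ← hP, ← sub_eq_iff_eq_add, ← Submodule.Quotient.mk_sub] at this
    rw [← this, CharTwo.sub_eq_add]
  have hPr : Submodule.Quotient.mk (P + edge (p (a + (1, 0))) true) = pc (a + (1, 0)) := by
    rw [Submodule.Quotient.mk_add, hP, (h.pc_step a).1]
  have hPu : Submodule.Quotient.mk (P + edge (p (a + (0, 1))) false) = pc (a + (0, 1)) := by
    rw [Submodule.Quotient.mk_add, hP, (h.pc_step a).2]
  set y := corr p α β V c d P (Q + edge (p a) true) with hy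
  have hy3 : Q + edge (p a) false + edge (p (a + (1, 0))) true + edge (p (a + (0, 1))) false =
      Q + edge (p a) true + faceBd p (Pi.single (p a) 1) := by
    rw [faceBd_single_map]
    linear_combination (exp := 1) - cochain_add_self (edge (p a) true)
  have hyx : x0 * y = - (x0 * x3) ∧ y ^ 2 = x3 ^ 2 := by
    rw [hy3] at h3
    by_cases hao : p a = p o
    · rw [corr_add_face_base D h hP hao, ← hy] at h3
      rw [h0, corr_eq_zero_of_base D h hz hP hQ hao, h3]
      simp
    · rw [corr_add_face D h hP hao, ← hy] at h3
      rw [h3]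
      simp
  have A1 := corr_sq_add_edge (p := p) (α := α) (β := β) (V := V) (c := c) (d := d)
    (P := P) (Q := Q) (p a, false)
  have A2 := corr_sq_add_edge (p := p) (α := α) (β := β) (V := V) (c := c) (d := d)
    (P := P) (Q := Q + edge (p a) false) (p (a + (1, 0)), true)
  have A3 := corr_sq_add_edge (p := p) (α := α) (β := β) (V := V) (c := c) (d := d)
    (P := P) (Q := Q + edge (p a) false + edge (p (a + (1, 0))) true) (p (a + (0, 1)), false)
  have A4 := corr_sq_add_edge (p := p) (α := α) (β := β) (V := V) (c := c) (d := d)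
    (P := P) (Q := Q) (p a, true)
  rw [← corrSq_eq D hPd hQ, ← corrSq_eq D hPd hQ1, ← h0, ← h1] at A1
  rw [← corrSq_eq D hPr hQ1, ← corrSq_eq D hPr hQ2, ← h1, ← h2] at A2
  rw [← corrSq_eq D hPu hQ2, ← corrSq_eq D hPu hQ3, ← h2, ← h3] at A3
  rw [← corrSq_eq D hPl hQ, ← corrSq_eq D hPl hQ3', ← h0, ← hy] at A4
  rw [corrSq_eq D hP hQ, corrSq_eq D hP hQ1, corrSq_eq D hP hQ2, corrSq_eq D hP hQ3,
    ← h0, ← h1, ← h2, ← h3]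
  have hs : √2 * √2 = 2 := Real.mul_self_sqrt (by norm_num)
  linear_combination A1 + A2 + A3 + A4 + 3 * hyx.2 - 4 * √2 * hyx.1 -
    (x0 ^ 2 + x1 ^ 2 + x2 ^ 2 + x3 ^ 2) * hs

/-- By positivity of the defect, the correlations around each face obey a linear system. -/
lemma corr_face_relations (D : IsDualPair p w1 w2 α β) (h : IsLinePair p o pc qc)
    (hz : corr p α β V c d 0 0 = 0) {a : ℤ × ℤ} (hP : Submodule.Quotient.mk P = pc a)
    (hQ : Submodule.Quotient.mk Q = qc a) {x0 x1 x2 x3 : ℝ} (h0 : x0 = corr p α β V c d P Q)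
    (h1 : x1 = corr p α β V c d P (Q + edge (p a) false))
    (h2 : x2 = corr p α β V c d P (Q + edge (p a) false + edge (p (a + (1, 0))) true))
    (h3 : x3 = corr p α β V c d P (Q + edge (p a) false + edge (p (a + (1, 0))) true +
      edge (p (a + (0, 1))) false)) :
    x1 - x3 = √2 * x0 ∧ x0 + x2 = √2 * x1 ∧ x1 + x3 = √2 * x2 ∧ x2 - x0 = √2 * x3 := by
  let s := Function.surjInv D.surjective
  have hs (x : G) : p (s x) = x := Function.surjInv_eq D.surjective x
  let N (x : G) (k : ℤ × ℤ) : ℝ := corrSq α β V c d (pc (s x)) (qc (s x + k))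
  have hN (a k : ℤ × ℤ) : N (p a) k = corrSq α β V c d (pc a) (qc (a + k)) := by
    have := corrSq_translate (V := V) (c := c) (d := d) D h (l := s (p a) - a)
      (by rw [map_sub, hs, sub_self]) a (a + k)
    rw [← this, add_sub_cancel, show a + k + (s (p a) - a) = s (p a) + k by abel]
  let E (x : G) : ℝ := (N (x - p (0, 1)) (0, 1) + N (x - p (0, 1)) ((1, 0) + (0, 1))) +
      (N (x + p (1, 0)) 0 + N (x + p (1, 0)) (0, 1)) +
      (N (x + p (0, 1)) (1, 0) + N (x + p (0, 1)) 0) +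
      (N (x - p (1, 0)) ((1, 0) + (0, 1)) + N (x - p (1, 0)) (1, 0)) -
      2 * (N x 0 + N x (1, 0) + N x ((1, 0) + (0, 1)) + N x (0, 1))
  have hE (a : ℤ × ℤ) {P Q} (hP : Submodule.Quotient.mk P = pc a)
      (hQ : Submodule.Quotient.mk Q = qc a) := corrSq_defect D h hz hP hQ rfl rfl rfl rfl
  have hEq (a : ℤ × ℤ) : E (p a) =
      (corrSq α β V c d (pc (a - (0, 1))) (qc a) +
        corrSq α β V c d (pc (a - (0, 1))) (qc (a + (1, 0)))) +
      (corrSq α β V c d (pc (a + (1, 0))) (qc (a + (1, 0))) +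
        corrSq α β V c d (pc (a + (1, 0))) (qc (a + (1, 0) + (0, 1)))) +
      (corrSq α β V c d (pc (a + (0, 1))) (qc (a + (1, 0) + (0, 1))) +
        corrSq α β V c d (pc (a + (0, 1))) (qc (a + (0, 1)))) +
      (corrSq α β V c d (pc (a - (1, 0))) (qc (a + (0, 1))) +
        corrSq α β V c d (pc (a - (1, 0))) (qc a)) -
      2 * (corrSq α β V c d (pc a) (qc a) + corrSq α β V c d (pc a) (qc (a + (1, 0))) +
        corrSq α β V c d (pc a) (qc (a + (1, 0) + (0, 1))) +
        corrSq α β V c d (pc a) (qc (a + (0, 1)))) := by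
    simp only [E, ← map_sub, ← map_add, hN, add_zero, sub_add_cancel]
    rw [show a - (0, 1) + ((1, 0) + (0, 1)) = a + (1, 0) by abel,
      show a - (1, 0) + ((1, 0) + (0, 1)) = a + (0, 1) by abel, add_right_comm a (0, 1) (1, 0),
      add_assoc a (1, 0) (0, 1)]
  have hpos (x : G) : 0 ≤ E x := by
    obtain ⟨a, rfl⟩ := D.surjective x
    obtain ⟨P, hP⟩ := Submodule.Quotient.mk_surjective _ (pc a)
    obtain ⟨Q, hQ⟩ := Submodule.Quotient.mk_surjective _ (qc a)
    rw [hEq, hE a hP hQ]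
    positivity
  have hsum : ∑ x, E x = 0 := by
    have ha (y : G) (k : ℤ × ℤ) : ∑ x, N (x + y) k = ∑ x, N x k :=
      Fintype.sum_equiv (Equiv.addRight y) _ _ fun x => rfl
    have hb (y : G) (k : ℤ × ℤ) : ∑ x, N (x - y) k = ∑ x, N x k :=
      Fintype.sum_equiv (Equiv.subRight y) _ _ fun x => rfl
    simp only [E, Finset.sum_sub_distrib, Finset.sum_add_distrib, ← Finset.mul_sum, ha, hb]
    ring
  have hzero := (Finset.sum_eq_zero_iff_of_nonneg fun x _ => hpos x).1 hsum (p a)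
    (Finset.mem_univ _)
  rw [hEq, corrSq_defect D h hz hP hQ h0 h1 h2 h3] at hzero
  have q0 := sq_nonneg (x1 - x3 - √2 * x0)
  have q1 := sq_nonneg (x0 + x2 - √2 * x1)
  have q2 := sq_nonneg (x1 + x3 - √2 * x2)
  have q3 := sq_nonneg (x2 - x0 - √2 * x3)
  refine ⟨sub_eq_zero.1 ?_, sub_eq_zero.1 ?_, sub_eq_zero.1 ?_, sub_eq_zero.1 ?_⟩ <;>
    refine sq_eq_zero_iff.1 (le_antisymm ?_ (sq_nonneg _)) <;> linarith

end Vanishing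

section Propagation

open scoped Matrix

variable {G : Type*} [AddCommGroup G] [DecidableEq G] [Fintype G]
  {p : ℤ × ℤ →+ G} {w1 w2 o : ℤ × ℤ} {α β : G × Bool → ZMod 2}
  {pc : ℤ × ℤ → (G × Bool → ZMod 2) ⧸ LinearMap.range (cob p)}
  {qc : ℤ × ℤ → (G × Bool → ZMod 2) ⧸ LinearMap.range (faceBd p)}
  {V : G → ZMod 2} {c d : ZMod 2} {P Q : G × Bool → ZMod 2}

lemma corr_corner (D : IsDualPair p w1 w2 α β) (h : IsLinePair p o pc qc)
    (hz : corr p α β V c d 0 0 = 0) {a : ℤ × ℤ} (hao : p a ≠ p o)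
    (hP : Submodule.Quotient.mk P = pc a) (hQ : Submodule.Quotient.mk Q = qc a) :
    corr p α β V c d P (Q + edge (p a) false) + corr p α β V c d P (Q + edge (p a) true) =
      √2 * corr p α β V c d P Q := by
  rw [← (corr_face_relations D h hz hP hQ rfl rfl rfl rfl).1, sub_eq_add_neg,
    ← corr_add_face D h hP hao, faceBd_single_map]
  congr 2
  linear_combination (exp := 1) - cochain_add_self (edge (p a) false) -
    cochain_add_self (edge (p (a + (1, 0))) true) - cochain_add_self (edge (p (a + (0, 1))) false)

lemma corr_corner_right (D : IsDualPair p w1 w2 α β) (h : IsLinePair p o pc qc)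
    (hz : corr p α β V c d 0 0 = 0) {a : ℤ × ℤ}
    (hP : Submodule.Quotient.mk P = pc a) (hQ : Submodule.Quotient.mk Q = qc (a + (1, 0))) :
    corr p α β V c d P (Q + edge (p a) false) +
      corr p α β V c d P (Q + edge (p (a + (1, 0))) true) = √2 * corr p α β V c d P Q := by
  have hQ' : Submodule.Quotient.mk (Q + edge (p a) false) = qc a := by
    rw [Submodule.Quotient.mk_add, hQ, (h.qc_step a).1, add_assoc, ← Submodule.Quotient.mk_add,
      cochain_add_self, Submodule.Quotient.mk_zero, add_zero]
  have := (corr_face_relations D h hz hP hQ' rfl rfl rfl rfl).2.1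
  rwa [add_assoc Q, cochain_add_self, add_zero] at this

lemma corr_corner_right_up (D : IsDualPair p w1 w2 α β) (h : IsLinePair p o pc qc)
    (hz : corr p α β V c d 0 0 = 0) {a : ℤ × ℤ}
    (hP : Submodule.Quotient.mk P = pc a)
    (hQ : Submodule.Quotient.mk Q = qc (a + (1, 0) + (0, 1))) :
    corr p α β V c d P (Q + edge (p (a + (1, 0))) true) +
      corr p α β V c d P (Q + edge (p (a + (0, 1))) false) = √2 * corr p α β V c d P Q := by
  have hQ' : Submodule.Quotient.mk (Q + edge (p a) false + edge (p (a + (1, 0))) true) = qc a := by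
    rw [Submodule.Quotient.mk_add, Submodule.Quotient.mk_add, hQ, (h.qc_step _).2, (h.qc_step a).1,
      ← sub_eq_zero]
    rw [show ∀ x y z : (G × Bool → ZMod 2) ⧸ LinearMap.range (faceBd p),
      x + y + z + y + z - x = (y + y) + (z + z) by intros; abel]
    simp only [← Submodule.Quotient.mk_add, cochain_add_self, Submodule.Quotient.mk_zero, add_zero]
  have := (corr_face_relations D h hz hP hQ' rfl rfl rfl rfl).2.2.1
  rwa [show Q + edge (p a) false + edge (p (a + (1, 0))) true + edge (p a) false =
      Q + edge (p (a + (1, 0))) true by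
        linear_combination (exp := 1) cochain_add_self (edge (p a) false),
    add_assoc Q _ (edge _ true), cochain_add_self, add_zero] at this

lemma corr_corner_up (D : IsDualPair p w1 w2 α β) (h : IsLinePair p o pc qc)
    (hz : corr p α β V c d 0 0 = 0) {a : ℤ × ℤ}
    (hP : Submodule.Quotient.mk P = pc a) (hQ : Submodule.Quotient.mk Q = qc (a + (0, 1))) :
    corr p α β V c d P (Q + edge (p (a + (0, 1))) false) +
      corr p α β V c d P (Q + edge (p a) true) = √2 * corr p α β V c d P Q := by
  have hQ' : Submodule.Quotient.mk (Q + edge (p a) true) = qc a := by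
    rw [Submodule.Quotient.mk_add, hQ, (h.qc_step a).2, add_assoc, ← Submodule.Quotient.mk_add,
      cochain_add_self, Submodule.Quotient.mk_zero, add_zero]
  have key := (corr_face_relations D h hz hP hQ' rfl rfl rfl rfl).2.2.2
  rw [show Q + edge (p a) true + edge (p a) false + edge (p (a + (1, 0))) true +
      edge (p (a + (0, 1))) false = Q + faceBd p (Pi.single (p a) 1) by
        rw [faceBd_single_map]; abel,
    show Q + edge (p a) true + edge (p a) false + edge (p (a + (1, 0))) true =
      Q + edge (p (a + (0, 1))) false + faceBd p (Pi.single (p a) 1) by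
        rw [faceBd_single_map]
        linear_combination (exp := 1) - cochain_add_self (edge (p (a + (0, 1))) false)] at key
  by_cases hao : p a = p o
  · rw [corr_add_face_base D h hP hao, corr_add_face_base D h hP hao] at key
    rw [corr_eq_zero_of_base D h hz hP hQ' hao] at key ⊢
    linarith
  · rw [corr_add_face D h hP hao, corr_add_face D h hP hao] at key
    linarith

/-- All four correlations around the face vanish. -/
def IsZeroFace (α β : G × Bool → ZMod 2) (V : G → ZMod 2) (c d : ZMod 2)
    (pc : ℤ × ℤ → (G × Bool → ZMod 2) ⧸ LinearMap.range (cob p))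
    (qc : ℤ × ℤ → (G × Bool → ZMod 2) ⧸ LinearMap.range (faceBd p)) (a : ℤ × ℤ) : Prop :=
  (corrSq α β V c d (pc a) (qc a) = 0 ∧ corrSq α β V c d (pc a) (qc (a + (1, 0))) = 0) ∧
    corrSq α β V c d (pc a) (qc (a + (1, 0) + (0, 1))) = 0 ∧
    corrSq α β V c d (pc a) (qc (a + (0, 1))) = 0

/-- Two adjacent zeros around a face force all four correlations to vanish. -/
lemma isZeroFace_of_adjacent (D : IsDualPair p w1 w2 α β) (h : IsLinePair p o pc qc)
    (hz : corr p α β V c d 0 0 = 0) {a : ℤ × ℤ}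
    (H : (corrSq α β V c d (pc a) (qc a) = 0 ∧ corrSq α β V c d (pc a) (qc (a + (1, 0))) = 0) ∨
      (corrSq α β V c d (pc a) (qc (a + (1, 0))) = 0 ∧
        corrSq α β V c d (pc a) (qc (a + (1, 0) + (0, 1))) = 0) ∨
      (corrSq α β V c d (pc a) (qc (a + (0, 1))) = 0 ∧
        corrSq α β V c d (pc a) (qc (a + (1, 0) + (0, 1))) = 0) ∨
      (corrSq α β V c d (pc a) (qc a) = 0 ∧ corrSq α β V c d (pc a) (qc (a + (0, 1))) = 0)) :
    IsZeroFace α β V c d pc qc a := by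
  obtain ⟨P, hP⟩ := Submodule.Quotient.mk_surjective _ (pc a)
  obtain ⟨Q, hQ⟩ := Submodule.Quotient.mk_surjective _ (qc a)
  obtain ⟨hQ1, hQ2, hQ3⟩ := h.qc_diag hQ
  have R := corr_face_relations D h hz hP hQ rfl rfl rfl rfl
  simp only [IsZeroFace]
  rw [corrSq_eq D hP hQ, corrSq_eq D hP hQ1, corrSq_eq D hP hQ2, corrSq_eq D hP hQ3] at H ⊢
  simp only [sq_eq_zero_iff] at H ⊢
  generalize corr p α β V c d P Q = x0 at *
  generalize corr p α β V c d P (Q + edge (p a) false) = x1 at *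
  generalize corr p α β V c d P
    (Q + edge (p a) false + edge (p (a + (1, 0))) true) = x2 at *
  generalize corr p α β V c d P (Q + edge (p a) false + edge (p (a + (1, 0))) true +
    edge (p (a + (0, 1))) false) = x3 at *
  obtain ⟨R0, R1, R2, R3⟩ := R
  rcases H with ⟨rfl, rfl⟩ | ⟨rfl, rfl⟩ | ⟨rfl, rfl⟩ | ⟨rfl, rfl⟩ <;>
    simp only [mul_zero, zero_add, add_zero, sub_zero, zero_sub] at R0 R1 R2 R3 <;>
    refine ⟨⟨?_, ?_⟩, ?_, ?_⟩ <;> linarith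

lemma corrSq_transfer (D : IsDualPair p w1 w2 α β)
    {x x' : (G × Bool → ZMod 2) ⧸ LinearMap.range (cob p)}
    {y y' : (G × Bool → ZMod 2) ⧸ LinearMap.range (faceBd p)} (e : G × Bool)
    (hx : x' = x + Submodule.Quotient.mk (Pi.single e 1))
    (hy : y' = y + Submodule.Quotient.mk (Pi.single e 1)) :
    (corrSq α β V c d x y = 0 ∧ corrSq α β V c d x y' = 0) ↔
      (corrSq α β V c d x' y = 0 ∧ corrSq α β V c d x' y' = 0) := by
  suffices H : ∀ x x' : (G × Bool → ZMod 2) ⧸ LinearMap.range (cob p),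
      x' = x + Submodule.Quotient.mk (Pi.single e 1) →
      (corrSq α β V c d x y = 0 ∧ corrSq α β V c d x y' = 0) →
      (corrSq α β V c d x' y = 0 ∧ corrSq α β V c d x' y' = 0) by
    refine ⟨H x x' hx, H x' x ?_⟩
    rw [hx, add_assoc, ← Submodule.Quotient.mk_add, cochain_add_self, Submodule.Quotient.mk_zero,
      add_zero]
  rintro x x' rfl
  obtain ⟨P, rfl⟩ := Submodule.Quotient.mk_surjective _ x
  obtain ⟨Q, rfl⟩ := Submodule.Quotient.mk_surjective _ y
  rw [hy]
  simp only [← Submodule.Quotient.mk_add, corrSq_mk D.faceSum_left D.faceSum_right,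
    sq_eq_zero_iff]
  rintro ⟨h0, h1⟩
  rw [corr_add_edge_add_edge, corr_add_single, h0, h1]
  simp

lemma isZeroFace_iff_right (D : IsDualPair p w1 w2 α β) (h : IsLinePair p o pc qc)
    (hz : corr p α β V c d 0 0 = 0) (a : ℤ × ℤ) :
    IsZeroFace α β V c d pc qc a ↔ IsZeroFace α β V c d pc qc (a + (1, 0)) := by
  have T := corrSq_transfer (V := V) (c := c) (d := d) D (p (a + (1, 0)), true) (h.pc_step a).1
    (h.qc_step (a + (1, 0))).2
  constructor <;> intro H
  · obtain ⟨h0, h1⟩ := T.1 ⟨H.1.2, H.2.1⟩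
    exact isZeroFace_of_adjacent D h hz (.inr (.inr (.inr ⟨h0, h1⟩)))
  · obtain ⟨h0, h1⟩ := T.2 ⟨H.1.1, H.2.2⟩
    exact isZeroFace_of_adjacent D h hz (.inr (.inl ⟨h0, h1⟩))

lemma isZeroFace_iff_up (D : IsDualPair p w1 w2 α β) (h : IsLinePair p o pc qc)
    (hz : corr p α β V c d 0 0 = 0) (a : ℤ × ℤ) :
    IsZeroFace α β V c d pc qc a ↔ IsZeroFace α β V c d pc qc (a + (0, 1)) := by
  have T := corrSq_transfer (V := V) (c := c) (d := d) D (p (a + (0, 1)), false) (h.pc_step a).2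
    (h.qc_step (a + (0, 1))).1
  rw [add_right_comm] at T
  constructor <;> intro H
  · obtain ⟨h0, h1⟩ := T.1 ⟨H.2.2, H.2.1⟩
    rw [add_right_comm] at h1
    exact isZeroFace_of_adjacent D h hz (.inl ⟨h0, h1⟩)
  · have h1 := H.1.2
    rw [add_right_comm] at h1
    obtain ⟨h0, h1⟩ := T.2 ⟨H.1.1, h1⟩
    exact isZeroFace_of_adjacent D h hz (.inr (.inr (.inl ⟨h0, h1⟩)))

end Propagation

section Vertex

open scoped Matrix

variable {G : Type*} [AddCommGroup G] [DecidableEq G] [Fintype G]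
  {p : ℤ × ℤ →+ G} {w1 w2 o : ℤ × ℤ} {α β : G × Bool → ZMod 2}
  {pc : ℤ × ℤ → (G × Bool → ZMod 2) ⧸ LinearMap.range (cob p)}
  {qc : ℤ × ℤ → (G × Bool → ZMod 2) ⧸ LinearMap.range (faceBd p)}
  {V : G → ZMod 2} {c d : ZMod 2} {P Q : G × Bool → ZMod 2}

lemma corr_corner_dual {e e' : G × Bool}
    (H : corr p α β V c d P (Q + Pi.single e 1) + corr p α β V c d P (Q + Pi.single e' 1) =
      √2 * corr p α β V c d P Q) :
    sg (Q e) * corr p α β V c d (P + Pi.single e 1) Q +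
      sg (Q e') * corr p α β V c d (P + Pi.single e' 1) Q = √2 * corr p α β V c d P Q := by
  rw [corr_add_single, corr_add_single, ← mul_assoc, ← mul_assoc, sg_mul_self, sg_mul_self]
  linear_combination - H

/-- A linear system with signs whose only solution is zero. -/
lemma eq_zero_of_twisted_cycle {y0 y1 y2 y3 qr qu ql qd : ℝ} (hu : qu * qu = 1)
    (hl : ql * ql = 1) (hd : qd * qd = 1) (hq : qr = - (qu * ql * qd))
    (h0 : - (qr * y3) + qu * y1 = √2 * y0) (h1 : ql * y2 + qu * y0 = √2 * y1)
    (h2 : qd * y3 + ql * y1 = √2 * y2) (h3 : - (qr * y0) + qd * y2 = √2 * y3) :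
    y0 = 0 ∧ y3 = 0 := by
  have hs : √2 * √2 = 2 := Real.mul_self_sqrt (by norm_num)
  subst hq
  have k0 : y0 = 0 := by
    have a1 : y0 + qu * ql * y2 = √2 * (qu * y1) := by linear_combination qu * h1 - y0 * hu
    have a2 : √2 * y0 = √2 * (qu * ql * y2) := by
      linear_combination qu * ql * h2 - h0 - qu * y1 * hl
    have a3 := mul_left_cancel₀ (show √2 ≠ 0 by positivity) a2
    have a4 : qu * ql * qd * (y0 * (qu * ql * qd)) = y0 := by
      linear_combination y0 * (ql * ql * qd * qd * hu + qd * qd * hl + hd)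
    have a5 : √2 * (qu * y1) = √2 * (qu * ql * qd * y3) := by
      linear_combination - a1 + qu * ql * qd * h3 - a4 - qu * ql * y2 * hd
    have a6 := mul_left_cancel₀ (show √2 ≠ 0 by positivity) a5
    have a7 : 2 * (2 * y0) = 2 * y0 := by
      linear_combination √2 * h0 + y0 * hs + √2 * a6 + 2 * a1 + 2 * a3
    linarith
  refine ⟨k0, ?_⟩
  subst k0
  have b1 : 2 * (√2 * y3) = 0 := by
    linear_combination - h3 + ql * qd * h1 - qd * y2 * hl + √2 * ql * qd * (qu * h0 - y1 * hu) -
      √2 * y3 * (ql * ql * qd * qd * hu + qd * qd * hl + hd)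
  have : √2 * y3 = 0 := by linarith
  exact (mul_eq_zero.1 this).resolve_left (by positivity)

lemma exists_isZeroFace (D : IsDualPair p w1 w2 α β) (h : IsLinePair p o pc qc)
    (hz : corr p α β V c d 0 0 = 0) {b : ℤ × ℤ} (hVb : V (p b) = 1) (hbo : p b ≠ p o) :
    IsZeroFace α β V c d pc qc b := by
  obtain ⟨P, hP⟩ := Submodule.Quotient.mk_surjective _ (pc b)
  obtain ⟨Q, hQ⟩ := Submodule.Quotient.mk_surjective _ (qc b)
  set r : G × Bool → ZMod 2 := edge (p b) false with hr
  set u : G × Bool → ZMod 2 := edge (p b) true with hu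
  set l : G × Bool → ZMod 2 := edge (p (b - (1, 0))) false with hl
  set t : G × Bool → ZMod 2 := edge (p (b - (0, 1))) true with ht
  have mk2 (x : G × Bool → ZMod 2) : (Submodule.Quotient.mk x + Submodule.Quotient.mk x :
      (G × Bool → ZMod 2) ⧸ LinearMap.range (cob p)) = 0 := by
    rw [← Submodule.Quotient.mk_add, cochain_add_self, Submodule.Quotient.mk_zero]
  have hP1 : Submodule.Quotient.mk (P + u) = pc (b - (1, 0)) := by
    have := (h.pc_step (b - (1, 0))).1
    rw [sub_add_cancel] at this
    rw [Submodule.Quotient.mk_add, hP, this, add_assoc, mk2, add_zero]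
  have hP2 : Submodule.Quotient.mk (P + u + l) = pc (b - (1, 0) - (0, 1)) := by
    have := (h.pc_step (b - (1, 0) - (0, 1))).2
    rw [sub_add_cancel] at this
    rw [Submodule.Quotient.mk_add, hP1, this, add_assoc, mk2, add_zero]
  have hP3 : Submodule.Quotient.mk (P + u + l + t) = pc (b - (0, 1)) := by
    have := (h.pc_step (b - (1, 0) - (0, 1))).1
    rw [sub_right_comm, sub_add_cancel] at this
    rw [Submodule.Quotient.mk_add, hP2, this, sub_right_comm]
  have C0 := corr_corner D h hz hbo hP hQ
  have C1 := corr_corner_right D h hz hP1 (Q := Q) (by rw [sub_add_cancel, hQ])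
  have C2 := corr_corner_right_up D h hz hP2 (Q := Q)
    (by rw [sub_right_comm, sub_add_cancel, sub_add_cancel, hQ])
  have C3 := corr_corner_up D h hz hP3 (Q := Q) (by rw [sub_add_cancel, hQ])
  rw [sub_right_comm, sub_add_cancel, ← ht, sub_right_comm, sub_add_cancel] at C2
  rw [sub_add_cancel] at C1 C3
  have B0 : sg (Q (p b, false)) * corr p α β V c d (P + r) Q +
      sg (Q (p b, true)) * corr p α β V c d (P + u) Q = √2 * corr p α β V c d P Q :=
    corr_corner_dual C0
  have B1 : sg (Q (p (b - (1, 0)), false)) * corr p α β V c d (P + u + l) Q +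
      sg (Q (p b, true)) * corr p α β V c d (P + u + u) Q = √2 * corr p α β V c d (P + u) Q :=
    corr_corner_dual C1
  have B2 : sg (Q (p (b - (0, 1)), true)) * corr p α β V c d (P + u + l + t) Q +
      sg (Q (p (b - (1, 0)), false)) * corr p α β V c d (P + u + l + l) Q =
        √2 * corr p α β V c d (P + u + l) Q :=
    corr_corner_dual C2
  have B3 : sg (Q (p b, false)) * corr p α β V c d (P + u + l + t + r) Q +
      sg (Q (p (b - (0, 1)), true)) * corr p α β V c d (P + u + l + t + t) Q =
        √2 * corr p α β V c d (P + u + l + t) Q :=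
    corr_corner_dual C3
  have hcob : cob p (Pi.single (p b) 1) = r + u + l + t := by
    simp only [cob_single, hr, hu, hl, ht, map_sub]
  have hcorr (P : G × Bool → ZMod 2) :
      corr p α β V c d (P + cob p (Pi.single (p b) 1)) Q = - corr p α β V c d P Q := by
    rw [corr_add_cob, dotProduct_single, hVb]
    simp
  have e0 : P + r = P + u + l + t + cob p (Pi.single (p b) 1) := by
    rw [hcob]
    linear_combination (exp := 1) - cochain_add_self u - cochain_add_self l - cochain_add_self t
  have e1 : P + u + u = P := by rw [add_assoc, cochain_add_self, add_zero]
  have e2 : P + u + l + l = P + u := by rw [add_assoc _ l, cochain_add_self, add_zero]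
  have e3 : P + u + l + t + t = P + u + l := by rw [add_assoc _ t, cochain_add_self, add_zero]
  have e4 : P + u + l + t + r = P + cob p (Pi.single (p b) 1) := by rw [hcob]; abel
  rw [e0, hcorr] at B0
  rw [e1] at B1
  rw [e2] at B2
  rw [e3, e4, hcorr] at B3
  have hstar := congrFun (h.starSum_eq b hQ) (p b)
  simp only [starSum_apply, ← map_sub, Pi.add_apply, Pi.single_eq_same,
    Pi.single_eq_of_ne hbo, add_zero] at hstar
  have hprod := congrArg sg hstar
  simp only [sg_add, sg_one] at hprod
  set qr := sg (Q (p b, false))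
  set qu := sg (Q (p b, true))
  set ql := sg (Q (p (b - (1, 0)), false))
  set qd := sg (Q (p (b - (0, 1)), true))
  have hqu : qu * qu = 1 := sg_mul_self _
  have hql : ql * ql = 1 := sg_mul_self _
  have hqd : qd * qd = 1 := sg_mul_self _
  obtain ⟨k0, k3⟩ := eq_zero_of_twisted_cycle (qr := qr) hqu hql hqd
    (by linear_combination qu * ql * qd * hprod -
      qr * (ql * ql * qd * qd * hqu + qd * qd * hql + hqd))
    (by linear_combination B0) B1 B2 (by linear_combination B3)
  have kr : corr p α β V c d P (Q + u) = 0 := by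
    have : corr p α β V c d (P + r) Q = sg (Q (p b, false)) *
      (√2 * corr p α β V c d P Q - corr p α β V c d P (Q + r)) := corr_add_single (p b, false)
    rw [e0, hcorr, k3, neg_zero, eq_comm, mul_eq_zero] at this
    have := this.resolve_left (sg_ne_zero _)
    linarith
  refine isZeroFace_of_adjacent D h hz (.inr (.inr (.inr ⟨?_, ?_⟩)))
  · rw [corrSq_eq D hP hQ, k0, sq, mul_zero]
  · rw [(h.qc_step b).2, ← hQ, ← Submodule.Quotient.mk_add, corrSq_eq D hP rfl, kr, sq, mul_zero]

lemma corr_single_eq_zero (D : IsDualPair p w1 w2 α β) (hV : ∑ x, V x = 0) (hV0 : V ≠ 0)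
    (hz : corr p α β V c d 0 0 = 0) (e : G × Bool) : corr p α β V c d 0 (Pi.single e 1) = 0 := by
  obtain ⟨x, b⟩ := e
  obtain ⟨o, rfl⟩ := D.surjective x
  obtain ⟨pc, qc, h⟩ := exists_isLinePair p o
  obtain ⟨b', hb', hbo⟩ : ∃ b, V (p b) = 1 ∧ p b ≠ p o := by
    by_contra! H
    have H' (x : G) (hx : x ≠ p o) : V x = 0 := by
      obtain ⟨a, rfl⟩ := D.surjective x
      exact (zmod_two_cases _).resolve_right fun h1 => hx (H a h1)
    rw [Finset.sum_eq_single (p o) (fun x _ hx => H' x hx) (by simp)] at hV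
    refine hV0 (funext fun x => ?_)
    by_cases hx : x = p o
    · rw [hx, hV, Pi.zero_apply]
    · exact H' x hx
  have H := plane_induction (S := IsZeroFace α β V c d pc qc) b'
    (exists_isZeroFace D h hz hb' hbo) (isZeroFace_iff_right D h hz) (isZeroFace_iff_up D h hz) o
  have hP : Submodule.Quotient.mk 0 = pc o := by rw [h.pc_base, Submodule.Quotient.mk_zero]
  cases b with
  | false =>
    have H1 := H.1.2
    rwa [(h.qc_step o).1, h.qc_base, zero_add, corrSq_eq D hP rfl, sq_eq_zero_iff] at H1
  | true =>
    have H1 := H.2.2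
    rwa [(h.qc_step o).2, h.qc_base, zero_add, corrSq_eq D hP rfl, sq_eq_zero_iff] at H1

end Vertex

section Weights

variable {ι : Type*} [Fintype ι]

lemma wt_eq_pow (A : ι → ZMod 2) :
    wt A = wt (0 : ι → ZMod 2) * (√2 - 1) ^ (Finset.univ.filter fun e => A e = 1).card := by
  have h : ∑ e, sg (A e) = ∑ e : ι, sg ((0 : ι → ZMod 2) e) -
      2 * (Finset.univ.filter fun e => A e = 1).card := by
    rw [Finset.card_filter, Nat.cast_sum, Finset.mul_sum, ← Finset.sum_sub_distrib]
    refine Finset.sum_congr rfl fun e _ => ?_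
    rcases zmod_two_cases (A e) with he | he <;> norm_num [he]
  rw [wt, wt, h, ← exp_neg_two_betaC, ← Real.exp_nat_mul, ← Real.exp_add]
  ring_nf

lemma eq_single_of_wt_lt [DecidableEq ι] {A : ι → ZMod 2} (hA : A ≠ 0)
    (h : wt (0 : ι → ZMod 2) ≤ 3 * wt A) : ∃ e, A = Pi.single e 1 := by
  set s := Finset.univ.filter fun e => A e = 1 with hs
  have hsA (e : ι) : e ∈ s ↔ A e = 1 := by simp [hs]
  have hcard : s.card = 1 := by
    by_contra hc
    have h0 : s.card ≠ 0 := fun h0 => hA <| funext fun e => by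
      have : e ∉ s := by simp [Finset.card_eq_zero.1 h0]
      rw [hsA] at this
      exact (zmod_two_cases _).resolve_right this
    rw [wt_eq_pow A] at h
    have h2 : √2 * √2 = 2 := Real.mul_self_sqrt (by norm_num)
    have h3 : √2 < 3 / 2 := by
      rw [Real.sqrt_lt' (by norm_num)]; norm_num
    have h4 : 4 / 3 < √2 := by
      rw [Real.lt_sqrt (by norm_num)]; norm_num
    have h5 : (√2 - 1) ^ s.card ≤ (√2 - 1) ^ 2 :=
      pow_le_pow_of_le_one (by linarith) (by linarith) (by omega)
    have h6 : (√2 - 1) ^ s.card < 1 / 3 := by nlinarith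
    nlinarith [wt_pos (0 : ι → ZMod 2)]
  obtain ⟨e, he⟩ := Finset.card_eq_one.1 hcard
  refine ⟨e, funext fun e' => ?_⟩
  by_cases hee : e' = e
  · rw [hee, Pi.single_eq_same, ← hsA, he, Finset.mem_singleton]
  · rw [Pi.single_eq_of_ne hee]
    refine (zmod_two_cases _).resolve_right fun h1 => hee ?_
    rwa [← hsA, he, Finset.mem_singleton] at h1

lemma wt_le (A : ι → ZMod 2) : wt A ≤ wt (0 : ι → ZMod 2) := by
  have h2 : √2 < 2 := by
    rw [Real.sqrt_lt' (by norm_num)]; norm_num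
  have h1 : 1 < √2 := by
    rw [Real.lt_sqrt (by norm_num)]; norm_num
  rw [wt_eq_pow]
  exact mul_le_of_le_one_right (wt_pos _).le (pow_le_one₀ (by linarith) (by linarith))

end Weights

section Ending

open scoped Matrix

variable {G : Type*} [AddCommGroup G] {p : ℤ × ℤ →+ G}

lemma eq_const_of_cob_eq_zero (hp : Function.Surjective p) {κ : G → ZMod 2}
    (h : cob p κ = 0) (x : G) : κ x = κ 0 := by
  obtain ⟨a, rfl⟩ := hp x
  refine plane_induction (S := fun a => κ (p a) = κ 0) 0 (by rw [map_zero])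
    (fun a => ?_) (fun a => ?_) a
  · have := congrFun h (p a, false)
    rw [cob_apply_false, Pi.zero_apply, CharTwo.add_eq_zero] at this
    rw [map_add, this]
  · have := congrFun h (p a, true)
    rw [cob_apply_true, Pi.zero_apply, CharTwo.add_eq_zero] at this
    rw [map_add, this]

lemma map_eq_zero_of_steps (h1 : p (1, 0) = 0) (h2 : p (0, 1) = 0) (a : ℤ × ℤ) : p a = 0 :=
  plane_induction (S := fun a => p a = 0) 0 (map_zero p) (fun a => by simp [h1])
    (fun a => by simp [h2]) a

variable [DecidableEq G]

/-- A closed cochain other than zero whose weight is more than a third of the maximal one consists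
of a single edge, and adding it to a coboundary can increase the weight. -/
lemma exists_wt_lt [Fintype G] [Nontrivial G] (hp : Function.Surjective p) {ε : G × Bool → ZMod 2}
    (hε : faceSum p ε = 0) (hε0 : ε ≠ 0) (hw : wt (0 : G × Bool → ZMod 2) ≤ 3 * wt ε) :
    ∃ κ, wt (cob p κ) < wt (cob p κ + ε) := by
  obtain ⟨⟨x, b⟩, rfl⟩ := eq_single_of_wt_lt hε0 hw
  refine ⟨Pi.single x 1, ?_⟩
  have hstep (s : ℤ × ℤ) (h : (Pi.single x 1 + Pi.single (x - p s) 1 : G → ZMod 2) = 0) :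
      p s = 0 := by
    by_contra hs
    simpa [hs] using congrFun h x
  have hne : ¬ (p (1, 0) = 0 ∧ p (0, 1) = 0) := fun ⟨h1, h2⟩ => by
    obtain ⟨y, hy⟩ := exists_ne (0 : G)
    obtain ⟨a, rfl⟩ := hp y
    exact hy (map_eq_zero_of_steps h1 h2 a)
  have hx : cob p (Pi.single x 1) (x, b) = 1 := by
    cases b with
    | false =>
      rw [faceSum_edge_false] at hε
      have := fun h => hne ⟨h, hstep _ hε⟩
      simpa [cob_apply_false, Pi.single_apply] using this
    | true =>
      rw [faceSum_edge_true] at hε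
      have := fun h => hne ⟨hstep _ hε, h⟩
      simpa [cob_apply_true, Pi.single_apply] using this
  rw [wt_add_single, hx, sg_one]
  refine lt_mul_of_one_lt_right (wt_pos _) ?_
  have : 0 < √2 := by positivity
  linarith

/-- The four twisted weights of a configuration cannot cancel for all configurations. -/
lemma exists_twisted_weight_ne_zero [Fintype G] [Nontrivial G] (hp : Function.Surjective p)
    {α β : G × Bool → ZMod 2} (hα : faceSum p α = 0) (hβ : faceSum p β = 0) (hα0 : α ≠ 0)
    (hβ0 : β ≠ 0) (hαβ0 : α + β ≠ 0) (a b : ZMod 2) :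
    ∃ σ, ∑ i : ZMod 2, ∑ j : ZMod 2, sg (a * i + b * j + i * j) *
      wt (cob p σ + i • α + j • β) ≠ 0 := by
  by_contra! H
  have H' (σ : G → ZMod 2) : wt (cob p σ) + sg a * wt (cob p σ + α) +
      sg b * wt (cob p σ + β) - sg a * sg b * wt (cob p σ + (α + β)) = 0 := by
    have univ2 : (Finset.univ : Finset (ZMod 2)) = {0, 1} := rfl
    have := H σ
    simp only [univ2, Finset.sum_pair (zero_ne_one (α := ZMod 2)), sg_add, mul_zero, mul_one,
      sg_zero, sg_one, zero_smul, one_smul, add_zero, zero_add, one_mul, add_assoc] at this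
    linarith
  have hwα := wt_pos α
  have hwβ := wt_pos β
  have hwαβ := wt_pos (α + β)
  have hlα := wt_le α
  have hlβ := wt_le β
  have hlαβ := wt_le (α + β)
  have H0 := H' 0
  simp only [map_zero, zero_add] at H0
  obtain ⟨ha, hb⟩ : sg a = -1 ∧ sg b = -1 := by
    rcases sg_eq_one_or a with ha | ha <;> rcases sg_eq_one_or b with hb | hb <;>
      rw [ha, hb] at H0 <;> first | exact ⟨ha, hb⟩ | (exfalso; linarith)
  simp only [ha, hb] at H' H0
  obtain ⟨ε, hε, hε0, hεw, hεle⟩ : ∃ ε : G × Bool → ZMod 2, faceSum p ε = 0 ∧ ε ≠ 0 ∧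
      wt (0 : G × Bool → ZMod 2) ≤ 3 * wt ε ∧ ∀ σ, wt (cob p σ + ε) < wt (cob p σ) := by
    have hpos (σ : G → ZMod 2) := And.intro (wt_pos (cob p σ + α))
      (And.intro (wt_pos (cob p σ + β)) (wt_pos (cob p σ + (α + β))))
    by_cases h1 : wt (0 : G × Bool → ZMod 2) ≤ 3 * wt α
    · exact ⟨α, hα, hα0, h1, fun σ => by linarith [H' σ, hpos σ]⟩
    by_cases h2 : wt (0 : G × Bool → ZMod 2) ≤ 3 * wt β
    · exact ⟨β, hβ, hβ0, h2, fun σ => by linarith [H' σ, hpos σ]⟩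
    · refine ⟨α + β, by rw [map_add, hα, hβ, add_zero], hαβ0, ?_,
        fun σ => by linarith [H' σ, hpos σ]⟩
      linarith
  obtain ⟨κ, hκ⟩ := exists_wt_lt hp hε hε0 hεw
  exact lt_asymm hκ (hεle κ)

end Ending

section Spanning

open scoped Matrix

lemma exists_dot_eq {K ι κ : Type*} [Field K] [Fintype ι] [DecidableEq ι] {u : κ → ι → K}
    (hu : LinearIndependent K u) (g : κ → K) : ∃ ψ : ι → K, ∀ k, u k ⬝ᵥ ψ = g k := by
  obtain ⟨φ, hφ⟩ := LinearMap.exists_extend ((Module.Basis.span hu).constr K g)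
  refine ⟨fun x => φ (Pi.single x 1), fun k => ?_⟩
  have h1 : φ (u k) = g k := by
    have h2 := LinearMap.congr_fun hφ (Module.Basis.span hu k)
    rw [Module.Basis.constr_basis, LinearMap.comp_apply, Submodule.subtype_apply,
      Module.Basis.span_apply] at h2
    exact h2
  rw [← h1, LinearMap.pi_apply_eq_sum_univ φ (u k), dotProduct]
  refine Finset.sum_congr rfl fun x _ => ?_
  rw [smul_eq_mul]
  congr 2
  ext y
  simp [Pi.single_apply, eq_comm]

lemma sum_starSum {G : Type*} [AddCommGroup G] [Fintype G] {p : ℤ × ℤ →+ G}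
    (Q : G × Bool → ZMod 2) : ∑ x, starSum p Q x = 0 := by
  have h : starSum p Q ⬝ᵥ 1 = Q ⬝ᵥ cob p 1 := (dot_cob p Q 1).symm
  have h1 : cob p 1 = 0 := by
    ext ⟨x, b⟩
    simp [cob, CharTwo.add_self_eq_zero]
  rwa [h1, dotProduct_zero, dotProduct_one] at h

lemma IsDualPair.not_exact {G : Type*} [AddCommGroup G] [DecidableEq G] {p : ℤ × ℤ →+ G}
    {w1 w2 : ℤ × ℤ} {α β : G × Bool → ZMod 2} (D : IsDualPair p w1 w2 α β) (κ : G → ZMod 2) :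
    α + cob p κ ≠ 0 ∧ β + cob p κ ≠ 0 ∧ α + β + cob p κ ≠ 0 := by
  have h2 (x : ZMod 2) : x + x = 0 := CharTwo.add_self_eq_zero x
  have hκ : ∀ a, κ (p (a + (1, 0))) = κ (p a) + cob p κ (p a, false) ∧
      κ (p (a + (0, 1))) = κ (p a) + cob p κ (p a, true) := fun a => by
    rw [cob_apply_false, cob_apply_true, ← map_add, ← map_add, ← add_assoc, ← add_assoc, h2,
      zero_add, zero_add]
    exact ⟨rfl, rfl⟩
  have hw1 (a : ℤ × ℤ) : κ (p (a + w1)) = κ (p a) := by rw [map_add, D.map_left, add_zero]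
  have hw2 (a : ℤ × ℤ) : κ (p (a + w2)) = κ (p a) := by rw [map_add, D.map_right, add_zero]
  have eqκ {ε : G × Bool → ZMod 2} (h : ε + cob p κ = 0) : ε = cob p κ :=
    funext fun e => CharTwo.add_eq_zero.1 (congrFun h e)
  refine ⟨fun h => ?_, fun h => ?_, fun h => ?_⟩
  · have := (D.potential_left (fun a => κ (p a)) (by rw [eqκ h]; exact hκ) 0).2
    simp only [hw2] at this
    simp at this
  · have := (D.potential_right (fun a => κ (p a)) (by rw [eqκ h]; exact hκ) 0).1
    simp only [hw1] at this
    simp at this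
  · obtain ⟨F, -, hF⟩ := exists_plane_primitive (fun a => α (p a, false)) (fun a => α (p a, true))
      (fun a => by
        have := congrFun D.faceSum_left (p a)
        rw [faceSum_apply, Pi.zero_apply, ← map_add, ← map_add] at this
        linear_combination this - h2 (α (p a, true)) - h2 (α (p (a + (0, 1)), false))) 0
    have hβ : β = α + cob p κ := funext fun e => by
      have := congrFun h e
      simp only [Pi.add_apply, Pi.zero_apply] at this ⊢
      linear_combination this - h2 (α e) - h2 (cob p κ e)
    have hα := D.potential_left F hF 0
    have := D.potential_right (fun a => F a + κ (p a)) (fun a => by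
      rw [(hκ a).1, (hκ a).2, (hF a).1, (hF a).2, hβ, Pi.add_apply, Pi.add_apply]
      constructor <;> ring) 0
    simp only [hw1, hα.1] at this
    simp at this

variable {G : Type*} [AddCommGroup G] [DecidableEq G] [Fintype G]
  {p : ℤ × ℤ →+ G} {w1 w2 o : ℤ × ℤ} {α β : G × Bool → ZMod 2}
  {V : G → ZMod 2} {a b : ZMod 2}

lemma corr_single (e : G × Bool) : corr p α β V a b 0 (Pi.single e 1) =
    corr p α β (V + starSum p (Pi.single e 1)) (a + α e) (b + β e) 0 0 := by
  refine Finset.sum_congr rfl fun i _ => Finset.sum_congr rfl fun j _ =>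
    Finset.sum_congr rfl fun σ _ => ?_
  congr 2
  have h : starSum p (Pi.single e 1) ⬝ᵥ σ = cob p σ e := by
    rw [← dot_cob, single_dotProduct, one_mul]
  simp only [single_dotProduct, add_dotProduct, zero_dotProduct, h, Pi.add_apply, Pi.smul_apply,
    Pi.zero_apply, smul_eq_mul]
  ring

/-- If the correlation of `V` vanishes, so does the correlation of any homologous set of spins, up
to a change of the spin structure signs. -/
lemma exists_propagation (D : IsDualPair p w1 w2 α β) (hV : ∑ x, V x = 0) (hV0 : V ≠ 0)
    (hz : corr p α β V a b 0 0 = 0) : ∃ ψ₁ ψ₂ : G → ZMod 2, ∀ Q,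
      corr p α β (V + starSum p Q) (a + starSum p Q ⬝ᵥ ψ₁) (b + starSum p Q ⬝ᵥ ψ₂) 0 0 = 0 := by
  obtain ⟨κ, s, -, hspan, hind⟩ := exists_linearIndependent' (ZMod 2)
    fun e : G × Bool => starSum p (Pi.single e 1)
  obtain ⟨ψ₁, h₁⟩ := exists_dot_eq hind fun k => α (s k)
  obtain ⟨ψ₂, h₂⟩ := exists_dot_eq hind fun k => β (s k)
  simp only [Function.comp_apply] at h₁ h₂
  refine ⟨ψ₁, ψ₂, fun Q => ?_⟩
  let T : (G → ZMod 2) → Prop := fun D => ∑ x, D x = 0 ∧ ∀ (V : G → ZMod 2) (a b : ZMod 2),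
    ∑ x, V x = 0 → V ≠ 0 → corr p α β V a b 0 0 = 0 →
      corr p α β (V + D) (a + D ⬝ᵥ ψ₁) (b + D ⬝ᵥ ψ₂) 0 0 = 0
  have h0 : T 0 := ⟨by simp, fun V a b _ _ h => by simpa using h⟩
  have hmem : starSum p Q ∈ Submodule.span (ZMod 2)
      (Set.range ((fun e : G × Bool => starSum p (Pi.single e 1)) ∘ s)) := by
    rw [hspan]
    have hQ : Q ∈ Submodule.span (ZMod 2) (Set.range (Pi.basisFun (ZMod 2) (G × Bool))) := by
      rw [Module.Basis.span_eq]; trivial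
    have := Submodule.mem_map_of_mem (f := starSum p) hQ
    rwa [Submodule.map_span, ← Set.range_comp,
      show starSum p ∘ Pi.basisFun (ZMod 2) (G × Bool) = fun e => starSum p (Pi.single e 1) from
        funext fun e => by simp] at this
  have hT : T (starSum p Q) := by
    generalize starSum p Q = E at hmem ⊢
    induction hmem using Submodule.span_induction with
    | mem x hx =>
      obtain ⟨k, rfl⟩ := hx
      refine ⟨sum_starSum _, fun V a b hV hV0 hz => ?_⟩
      rw [Function.comp_apply, h₁, h₂, ← corr_single]
      exact corr_single_eq_zero D hV hV0 hz _
    | zero => exact h0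
    | smul c x _ hx =>
      rcases zmod_two_cases c with rfl | rfl
      · rwa [zero_smul]
      · rwa [one_smul]
    | add x y _ _ hx hy =>
      have key {x y : G → ZMod 2} (hx : T x) (hy : T y) {V : G → ZMod 2} {a b : ZMod 2}
          (hV : ∑ x, V x = 0) (hV0 : V ≠ 0) (hz : corr p α β V a b 0 0 = 0) (hVx : V ≠ x) :
          corr p α β (V + (x + y)) (a + (x + y) ⬝ᵥ ψ₁) (b + (x + y) ⬝ᵥ ψ₂) 0 0 = 0 := by
        have := hy.2 (V + x) _ _ (by simp [Finset.sum_add_distrib, hV, hx.1])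
          (fun h => hVx (funext fun z => CharTwo.add_eq_zero.1 (congrFun h z)))
          (hx.2 V a b hV hV0 hz)
        simpa only [add_dotProduct, add_assoc] using this
      refine ⟨by simp [Finset.sum_add_distrib, hx.1, hy.1], fun V a b hV hV0 hz => ?_⟩
      by_cases hVx : V = x
      · by_cases hVy : V = y
        · rw [← hVx, ← hVy, CharTwo.add_self_eq_zero]
          exact h0.2 V a b hV hV0 hz
        · rw [add_comm x y]
          exact key hy hx hV hV0 hz hVy
      · exact key hx hy hV hV0 hz hVx
  exact hT.2 V a b hV hV0 hz

lemma twisted_weight_eq_zero (hp : Function.Surjective p) (hV : ∑ x, V x = 0)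
    {ψ₁ ψ₂ : G → ZMod 2}
    (h : ∀ Q, corr p α β (V + starSum p Q) (a + starSum p Q ⬝ᵥ ψ₁) (b + starSum p Q ⬝ᵥ ψ₂) 0 0 = 0)
    (τ : G → ZMod 2) :
    ∑ i : ZMod 2, ∑ j : ZMod 2, sg ((a + V ⬝ᵥ ψ₁) * i + (b + V ⬝ᵥ ψ₂) * j + i * j) *
      wt (cob p τ + i • (α + cob p ψ₁) + j • (β + cob p ψ₂)) = 0 := by
  set m : (G → ZMod 2) → ℝ := fun σ => ∑ i : ZMod 2, ∑ j : ZMod 2,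
    sg ((a + V ⬝ᵥ ψ₁) * i + (b + V ⬝ᵥ ψ₂) * j + i * j) *
      wt (cob p σ + i • (α + cob p ψ₁) + j • (β + cob p ψ₂)) with hm
  have h2 (x : ZMod 2) : x + x = 0 := CharTwo.add_self_eq_zero x
  have h1 (Q : G × Bool → ZMod 2) : ∑ σ, sg (Q ⬝ᵥ cob p σ) * (sg (V ⬝ᵥ σ) * m σ) = 0 := by
    rw [← h Q, corr]
    simp only [hm, Finset.mul_sum]
    rw [Finset.sum_comm]
    refine Finset.sum_congr rfl fun i _ => ?_
    rw [Finset.sum_comm]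
    refine Finset.sum_congr rfl fun j _ => ?_
    refine Fintype.sum_equiv (Equiv.addRight (i • ψ₁ + j • ψ₂)) _ _ fun σ => ?_
    rw [← mul_assoc, ← mul_assoc, ← sg_add, ← sg_add, Equiv.coe_addRight]
    congr 2
    · simp only [dot_cob, zero_dotProduct, add_dotProduct, dotProduct_add, dotProduct_smul,
        smul_eq_mul]
      linear_combination - h2 (starSum p Q ⬝ᵥ ψ₁ * i) - h2 (starSum p Q ⬝ᵥ ψ₂ * j)
    · simp only [map_add, map_smul, smul_add, add_zero]
      abel
  have h3 : ∑ σ, sg (V ⬝ᵥ σ) * m σ * ∑ Q : G × Bool → ZMod 2, sg (Q ⬝ᵥ cob p (σ + τ)) = 0 := by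
    simp only [Finset.mul_sum]
    rw [Finset.sum_comm]
    refine Finset.sum_eq_zero fun Q _ => ?_
    rw [← mul_zero (sg (Q ⬝ᵥ cob p τ)), ← h1 Q, Finset.mul_sum]
    refine Finset.sum_congr rfl fun σ _ => ?_
    rw [map_add, dotProduct_add, sg_add]
    ring
  have h4 (σ : G → ZMod 2) : sg (V ⬝ᵥ σ) * m σ * ∑ Q : G × Bool → ZMod 2, sg (Q ⬝ᵥ cob p (σ + τ)) =
      sg (V ⬝ᵥ τ) * m τ * ∑ Q : G × Bool → ZMod 2, sg (Q ⬝ᵥ cob p (σ + τ)) := by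
    rw [sum_sg_dot]
    split_ifs with hσ
    · have hc : σ = τ + fun _ => (σ + τ) 0 := by
        ext x
        rw [Pi.add_apply, ← eq_const_of_cob_eq_zero hp hσ x, Pi.add_apply]
        linear_combination - h2 (τ x)
      have hVσ : V ⬝ᵥ σ = V ⬝ᵥ τ := by
        rw [hc, dotProduct_add, add_eq_left, dotProduct, ← Finset.sum_mul, hV, zero_mul]
      have hcob : cob p σ = cob p τ := by
        rw [map_add] at hσ
        exact funext fun e => CharTwo.add_eq_zero.1 (congrFun hσ e)
      simp only [hm, hcob, hVσ]
    · rw [mul_zero, mul_zero]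
  simp only [h4, ← Finset.mul_sum] at h3
  have h5 : ∑ σ : G → ZMod 2, ∑ Q : G × Bool → ZMod 2, sg (Q ⬝ᵥ cob p (σ + τ)) ≠ 0 := by
    refine ne_of_gt ?_
    simp only [sum_sg_dot]
    refine Finset.sum_pos' (fun σ _ => by split_ifs <;> positivity) ⟨τ, Finset.mem_univ _, ?_⟩
    rw [if_pos]
    · exact_mod_cast Fintype.card_pos
    · rw [show τ + τ = 0 from funext fun x => h2 _, map_zero]
  exact (mul_eq_zero.1 ((mul_eq_zero.1 h3).resolve_right h5)).resolve_left (sg_ne_zero _)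

/-- The correlations of an even number of spins on a torus, twisted by the four spin structures,
do not vanish. -/
theorem corr_ne_zero (D : IsDualPair p w1 w2 α β) (hV : ∑ x, V x = 0) (hV0 : V ≠ 0) :
    corr p α β V a b 0 0 ≠ 0 := by
  intro hz
  obtain ⟨x, hx⟩ := Function.ne_iff.1 hV0
  have : Nontrivial G := by
    by_contra hG
    rw [not_nontrivial_iff_subsingleton] at hG
    exact hx (by rw [Pi.zero_apply, ← hV, Fintype.sum_subsingleton _ x])
  obtain ⟨ψ₁, ψ₂, h⟩ := exists_propagation D hV hV0 hz
  obtain ⟨σ, hσ⟩ := exists_twisted_weight_ne_zero (α := α + cob p ψ₁) (β := β + cob p ψ₂)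
    D.surjective (by rw [map_add, D.faceSum_left, faceSum_cob, add_zero])
    (by rw [map_add, D.faceSum_right, faceSum_cob, add_zero]) (D.not_exact ψ₁).1
    (D.not_exact ψ₂).2.1
    (by rw [add_add_add_comm, ← map_add]; exact (D.not_exact (ψ₁ + ψ₂)).2.2)
    (a + V ⬝ᵥ ψ₁) (b + V ⬝ᵥ ψ₂)
  exact hσ (twisted_weight_eq_zero D.surjective hV h σ)

end Spanning

/-! ## Dual loops -/

lemma card_torusV {w1 w2 : ℤ × ℤ} (hdet : w1.1 * w2.2 - w1.2 * w2.1 ≠ 0)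
    {L : AddSubgroup (ℤ × ℤ)} (hL : L = AddSubgroup.closure {w1, w2}) :
    (Nat.card (TorusV L) : ℤ) = |w1.1 * w2.2 - w1.2 * w2.1| := by
  have hmem : ∀ i, ![w1, w2] i ∈ L := by
    rw [hL, Fin.forall_fin_two]
    exact ⟨AddSubgroup.subset_closure (by simp), AddSubgroup.subset_closure (by simp)⟩
  let u : Fin 2 → L := fun i => ⟨![w1, w2] i, hmem i⟩
  have hli : LinearIndependent ℤ u := by
    rw [Fintype.linearIndependent_iff]
    intro g hg
    rw [Fin.sum_univ_two] at hg
    have hg' : g 0 • w1 + g 1 • w2 = 0 := congrArg Subtype.val hg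
    have hx := congrArg Prod.fst hg'
    have hy := congrArg Prod.snd hg'
    simp only [Prod.fst_add, Prod.snd_add, Prod.smul_fst, Prod.smul_snd, smul_eq_mul, Prod.fst_zero,
      Prod.snd_zero] at hx hy
    rw [Fin.forall_fin_two]
    constructor
    · refine (mul_eq_zero.1 ?_).resolve_right hdet
      linear_combination w2.2 * hx - w2.1 * hy
    · refine (mul_eq_zero.1 ?_).resolve_right hdet
      linear_combination w1.1 * hy - w1.2 * hx
  have hsp : ⊤ ≤ Submodule.span ℤ (Set.range u) := by
    rintro ⟨x, hx⟩ -
    have hx' := hx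
    rw [hL, AddSubgroup.mem_closure_pair] at hx'
    obtain ⟨m, n, rfl⟩ := hx'
    have : (⟨m • w1 + n • w2, hx⟩ : L) = m • u 0 + n • u 1 := rfl
    rw [this]
    exact add_mem (Submodule.smul_mem _ _ (Submodule.subset_span ⟨0, rfl⟩))
      (Submodule.smul_mem _ _ (Submodule.subset_span ⟨1, rfl⟩))
  have h := AddSubgroup.index_eq_natAbs_det (Module.Basis.finTwoProd ℤ) L (Module.Basis.mk hli hsp)
  rw [AddSubgroup.index, Module.Basis.det_apply, Matrix.det_fin_two] at h
  rw [h, Int.natCast_natAbs]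
  simp [Module.Basis.toMatrix_apply, u]
  rw [mul_comm w2.1]

section Loops

variable {L : AddSubgroup (ℤ × ℤ)} {w : ℤ × ℤ}

lemma mem_stepSet {s : ℤ × ℤ} (h : s ∈ stepSet) :
    s = (1, 0) ∨ s = (-1, 0) ∨ s = (0, 1) ∨ s = (0, -1) := h

lemma crossEdge_right (d : ℤ × ℤ) :
    crossEdge L d (d + (1, 0)) = (QuotientAddGroup.mk' L (d + (1, 0)), true) := by
  simp [crossEdge]

lemma crossEdge_left (d : ℤ × ℤ) :
    crossEdge L d (d + (-1, 0)) = (QuotientAddGroup.mk' L d, true) := by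
  simp [crossEdge]

lemma crossEdge_up (d : ℤ × ℤ) :
    crossEdge L d (d + (0, 1)) = (QuotientAddGroup.mk' L (d + (0, 1)), false) := by
  simp [crossEdge]

lemma crossEdge_down (d : ℤ × ℤ) :
    crossEdge L d (d + (0, -1)) = (QuotientAddGroup.mk' L d, false) := by
  simp [crossEdge]

lemma mk_eq_mk_iff {a b : ℤ × ℤ} :
    QuotientAddGroup.mk' L a = QuotientAddGroup.mk' L b ↔ b - a ∈ L := by
  rw [QuotientAddGroup.mk'_apply, QuotientAddGroup.mk'_apply, QuotientAddGroup.eq, neg_add_eq_sub]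

/-- Two steps cross the same edge only if they are translates of each other, or translates of each
other's reversals. -/
lemma crossEdge_eq {d d' s s' : ℤ × ℤ} (hs : s ∈ stepSet) (hs' : s' ∈ stepSet)
    (h : crossEdge L d (d + s) = crossEdge L d' (d' + s')) :
    d' - d ∈ L ∨ (s' = -s ∧ d' - (d + s) ∈ L) := by
  have e (a b c : ℤ × ℤ) : a + c - (b + c) = a - b := add_sub_add_right_eq_sub a b c
  rcases mem_stepSet hs with rfl | rfl | rfl | rfl <;>
    rcases mem_stepSet hs' with rfl | rfl | rfl | rfl <;>
    simp only [crossEdge_right, crossEdge_left, crossEdge_up, crossEdge_down, Prod.mk.injEq,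
      mk_eq_mk_iff, reduceCtorEq, and_false, and_true, e] at h
  all_goals first
    | exact .inl h
    | exact .inr ⟨by simp, by simpa [sub_eq_add_neg, add_assoc] using h⟩

namespace DualLoop

variable (γ : DualLoop L w)

def crossed (t : ℤ) : TorusV L × Bool := crossEdge L (γ.pos t) (γ.pos (t + 1))

def dir (t : ℤ) : ℤ × ℤ := γ.pos (t + 1) - γ.pos t

lemma dir_mem (t : ℤ) : γ.dir t ∈ stepSet := γ.step t

lemma crossed_eq (t : ℤ) : γ.crossed t = crossEdge L (γ.pos t) (γ.pos t + γ.dir t) := by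
  rw [dir, add_sub_cancel, crossed]

lemma pos_len : γ.pos γ.len = γ.pos 0 + w := by
  rw [← γ.per, zero_add]

lemma crossed_ne (hw : w ∈ L) (hw0 : w ≠ 0) {t t' : ℤ} (h0 : 0 ≤ t) (ht : t < t')
    (ht' : t' < γ.len) : γ.crossed t ≠ γ.crossed t' := by
  intro h
  rw [crossed_eq, crossed_eq] at h
  rcases crossEdge_eq (γ.dir_mem t) (γ.dir_mem t') h with h | ⟨hs, h⟩
  · exact γ.simple t t' h0 ht ht' h
  · rw [dir, add_sub_cancel] at h
    rcases (Int.add_one_le_iff.2 ht).lt_or_eq with h1 | rfl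
    · exact γ.simple (t + 1) t' (by omega) h1 ht' h
    · have hpos : γ.pos (t + 1 + 1) = γ.pos t := by
        rw [dir, dir, neg_sub] at hs
        exact sub_left_injective hs
      rcases (show t + 1 + 1 ≤ γ.len by omega).lt_or_eq with h2 | h2
      · refine γ.simple t (t + 1 + 1) h0 (by omega) h2 ?_
        rw [hpos, sub_self]
        exact zero_mem L
      · rw [h2, pos_len] at hpos
        rcases h0.lt_or_eq with h3 | rfl
        · refine γ.simple 0 t le_rfl h3 (by omega) ?_
          rwa [← hpos, add_sub_cancel_left]
        · exact hw0 (add_eq_left.1 hpos)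

section Cochain

variable [DecidableEq (TorusV L)]

/-- The indicator of the edges crossed by a loop, as a cochain. -/
def cochain : TorusV L × Bool → ZMod 2 :=
  ∑ t ∈ Finset.range γ.len, Pi.single (γ.crossed t) 1

/-- The signed number of times each edge is crossed by a loop. -/
def flux : TorusV L × Bool → ℤ :=
  ∑ t ∈ Finset.range γ.len, ((γ.dir t).1 - (γ.dir t).2) • Pi.single (γ.crossed t) 1

lemma cochain_eq (hw : w ∈ L) (hw0 : w ≠ 0) (e : TorusV L × Bool) [Decidable (e ∈ crossedEdges γ)] :
    γ.cochain e = if e ∈ crossedEdges γ then 1 else 0 := by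
  rw [cochain, Finset.sum_apply]
  split_ifs with h
  · obtain ⟨t, h0, h1, rfl⟩ := h
    lift t to ℕ using h0
    rw [Finset.sum_eq_single t]
    · exact Pi.single_eq_same _ _
    · intro t' ht' hne
      rw [Finset.mem_range] at ht'
      refine Pi.single_eq_of_ne ?_ _
      rcases hne.lt_or_gt with hlt | hlt
      · exact (γ.crossed_ne hw hw0 (by omega) (by omega) h1).symm
      · exact γ.crossed_ne hw hw0 (by omega) (by omega) (by omega)
    · intro ht
      exact absurd (Finset.mem_range.2 (by omega)) ht
  · refine Finset.sum_eq_zero fun t ht => Pi.single_eq_of_ne ?_ _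
    rintro rfl
    exact h ⟨t, by omega, by exact_mod_cast Finset.mem_range.1 ht, rfl⟩

lemma cast_flux (e : TorusV L × Bool) : (γ.flux e : ZMod 2) = γ.cochain e := by
  rw [flux, cochain, Finset.sum_apply, Finset.sum_apply, Int.cast_sum]
  refine Finset.sum_congr rfl fun t _ => ?_
  have h1 : (-1 : ZMod 2) = 1 := rfl
  rcases mem_stepSet (γ.dir_mem t) with h | h | h | h <;> rw [h] <;>
    simp [Pi.single_apply, h1, apply_ite]

lemma flux_closed (hw : w ∈ L) (a : ℤ × ℤ) :
    γ.flux (QuotientAddGroup.mk' L a, false) + γ.flux (QuotientAddGroup.mk' L (a + (1, 0)), true) =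
      γ.flux (QuotientAddGroup.mk' L a, true) +
        γ.flux (QuotientAddGroup.mk' L (a + (0, 1)), false) := by
  have h1 : QuotientAddGroup.mk' L (-1, 0) = - QuotientAddGroup.mk' L (1, 0) := rfl
  have h2 : QuotientAddGroup.mk' L (0, -1) = - QuotientAddGroup.mk' L (0, 1) := rfl
  let i (d : ℤ × ℤ) : ℤ := if QuotientAddGroup.mk' L a = QuotientAddGroup.mk' L d then 1 else 0
  have key (d s : ℤ × ℤ) (hs : s ∈ stepSet) (e : TorusV L × Bool)
      (he : e = crossEdge L d (d + s)) :
      ((s.1 - s.2) • Pi.single e 1 : TorusV L × Bool → ℤ) (QuotientAddGroup.mk' L a, false) +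
      ((s.1 - s.2) • Pi.single e 1 : TorusV L × Bool → ℤ)
        (QuotientAddGroup.mk' L (a + (1, 0)), true) -
      (((s.1 - s.2) • Pi.single e 1 : TorusV L × Bool → ℤ) (QuotientAddGroup.mk' L a, true) +
      ((s.1 - s.2) • Pi.single e 1 : TorusV L × Bool → ℤ)
        (QuotientAddGroup.mk' L (a + (0, 1)), false)) = i d - i (d + s) := by
    subst he
    rcases mem_stepSet hs with rfl | rfl | rfl | rfl
    · simp [crossEdge_right, -QuotientAddGroup.mk'_apply, -QuotientAddGroup.coe_mk',
        Pi.single_apply, i]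
    · simp [crossEdge_left, -QuotientAddGroup.mk'_apply, -QuotientAddGroup.coe_mk',
        Pi.single_apply, i, h1, ← sub_eq_add_neg, eq_sub_iff_add_eq]
      split_ifs <;> rfl
    · simp [crossEdge_up, -QuotientAddGroup.mk'_apply, -QuotientAddGroup.coe_mk',
        Pi.single_apply, i]
      split_ifs <;> rfl
    · simp [crossEdge_down, -QuotientAddGroup.mk'_apply, -QuotientAddGroup.coe_mk',
        Pi.single_apply, i, h2, ← sub_eq_add_neg, eq_sub_iff_add_eq]
  rw [← sub_eq_zero]
  simp only [flux, Finset.sum_apply, ← Finset.sum_add_distrib, ← Finset.sum_sub_distrib]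
  rw [Finset.sum_congr rfl fun (t : ℕ) _ => key _ _ (γ.dir_mem t) _ (γ.crossed_eq t)]
  have : ∀ t : ℕ, i (γ.pos t) - i (γ.pos t + γ.dir t) = i (γ.pos t) - i (γ.pos (t + 1 : ℕ)) :=
    fun t => by rw [dir, add_sub_cancel, Nat.cast_add, Nat.cast_one]
  rw [Finset.sum_congr rfl fun t _ => this t, Finset.sum_range_sub', pos_len, sub_eq_zero]
  have hw' : QuotientAddGroup.mk' L w = 0 := (QuotientAddGroup.eq_zero_iff w).2 hw
  simp [i, -QuotientAddGroup.mk'_apply, -QuotientAddGroup.coe_mk', hw']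

variable [Fintype (TorusV L)]

lemma sum_flux : ∑ x, γ.flux (x, false) = - w.2 ∧ ∑ x, γ.flux (x, true) = w.1 := by
  have h : ∑ t ∈ Finset.range γ.len, γ.dir t = w := by
    have (t : ℕ) : γ.dir t = γ.pos (t + 1 : ℕ) - γ.pos t := by
      rw [dir, Nat.cast_add, Nat.cast_one]
    rw [Finset.sum_congr rfl fun t _ => this t, Finset.sum_range_sub (fun t : ℕ => γ.pos t),
      pos_len]
    simp
  have key (d s : ℤ × ℤ) (hs : s ∈ stepSet) (e : TorusV L × Bool)
      (he : e = crossEdge L d (d + s)) :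
      ∑ x, ((s.1 - s.2) • Pi.single e 1 : TorusV L × Bool → ℤ) (x, false) = - s.2 ∧
      ∑ x, ((s.1 - s.2) • Pi.single e 1 : TorusV L × Bool → ℤ) (x, true) = s.1 := by
    subst he
    rcases mem_stepSet hs with rfl | rfl | rfl | rfl
    · simp [crossEdge_right, Pi.single_apply]
    · simp [crossEdge_left, Pi.single_apply]
    · simp [crossEdge_up, Pi.single_apply]
    · simp [crossEdge_down, Pi.single_apply]
  constructor
  · simp only [flux, Finset.sum_apply]
    rw [Finset.sum_comm, Finset.sum_congr rfl fun (t : ℕ) _ =>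
      (key _ _ (γ.dir_mem t) _ (γ.crossed_eq t)).1,
      Finset.sum_neg_distrib, ← Prod.snd_sum]
    exact congrArg (fun x : ℤ × ℤ => - x.2) h
  · simp only [flux, Finset.sum_apply]
    rw [Finset.sum_comm, Finset.sum_congr rfl fun (t : ℕ) _ =>
      (key _ _ (γ.dir_mem t) _ (γ.crossed_eq t)).2,
      ← Prod.fst_sum]
    exact congrArg Prod.fst h

end Cochain

end DualLoop

end Loops

/-! ## The dual pair of a pair of loops -/

namespace DualLoop

variable {L : AddSubgroup (ℤ × ℤ)} {w : ℤ × ℤ} [DecidableEq (TorusV L)] (γ : DualLoop L w)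

lemma faceSum_cochain (hw : w ∈ L) : faceSum (QuotientAddGroup.mk' L) γ.cochain = 0 := by
  ext f
  obtain ⟨a, rfl⟩ := QuotientAddGroup.mk'_surjective L f
  have h := congrArg (Int.cast : ℤ → ZMod 2) (γ.flux_closed hw a)
  rw [Int.cast_add, Int.cast_add, cast_flux, cast_flux, cast_flux, cast_flux, map_add, map_add] at h
  rw [faceSum_apply, Pi.zero_apply]
  have h2 : (2 : ZMod 2) = 0 := rfl
  linear_combination h + (γ.cochain (QuotientAddGroup.mk' L a, true) +
    γ.cochain (QuotientAddGroup.mk' L a + QuotientAddGroup.mk' L (0, 1), false)) * h2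

lemma class_add (hw : w ∈ L)
    {pc : ℤ × ℤ → (TorusV L × Bool → ZMod 2) ⧸ LinearMap.range (cob (QuotientAddGroup.mk' L))}
    (hpc : ∀ a, pc (a + (1, 0)) =
        pc a + Submodule.Quotient.mk (edge (QuotientAddGroup.mk' L (a + (1, 0))) true) ∧
      pc (a + (0, 1)) =
        pc a + Submodule.Quotient.mk (edge (QuotientAddGroup.mk' L (a + (0, 1))) false))
    (a : ℤ × ℤ) : pc (a + w) = pc a + Submodule.Quotient.mk γ.cochain := by
  have step (d s : ℤ × ℤ) (hs : s ∈ stepSet) :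
      pc (d + s) = pc d + Submodule.Quotient.mk (Pi.single (crossEdge L d (d + s)) 1) := by
    have back (s : ℤ × ℤ) {b : Bool} (h : pc (d + -s + s) = pc (d + -s) +
        Submodule.Quotient.mk (edge (QuotientAddGroup.mk' L (d + -s + s)) b)) :
        pc (d + -s) = pc d + Submodule.Quotient.mk (edge (QuotientAddGroup.mk' L d) b) := by
      rw [neg_add_cancel_right] at h
      rw [h, add_assoc, ← Submodule.Quotient.mk_add, cochain_add_self, Submodule.Quotient.mk_zero,
        add_zero]
    rcases mem_stepSet hs with rfl | rfl | rfl | rfl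
    · rw [crossEdge_right]
      exact (hpc d).1
    · rw [crossEdge_left]
      exact back (1, 0) (hpc _).1
    · rw [crossEdge_up]
      exact (hpc d).2
    · rw [crossEdge_down]
      exact back (0, 1) (hpc _).2
  have tel (n : ℕ) : pc (γ.pos n) = pc (γ.pos 0) +
      Submodule.Quotient.mk (∑ t ∈ Finset.range n, Pi.single (γ.crossed t) 1) := by
    induction n with
    | zero => simp
    | succ n ih =>
      have h := step (γ.pos n) _ (γ.dir_mem n)
      rw [← crossed_eq, dir, add_sub_cancel, ih, add_assoc, ← Submodule.Quotient.mk_add] at h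
      rw [Finset.sum_range_succ, Nat.cast_add, Nat.cast_one, h]
  have hp (a : ℤ × ℤ) : QuotientAddGroup.mk' L (a + w) = QuotientAddGroup.mk' L a := by
    rw [map_add, show QuotientAddGroup.mk' L w = 0 from (QuotientAddGroup.eq_zero_iff w).2 hw,
      add_zero]
  have h := tel γ.len
  rw [pos_len, ← sub_eq_iff_eq_add'] at h
  rw [← sub_eq_iff_eq_add', cochain, ← h]
  exact plane_increment_const hpc (fun a => by rw [add_right_comm, hp])
    (fun a => by rw [add_right_comm, hp]) _ _

variable [Fintype (TorusV L)]

/-- The intersection number of a loop with a period. -/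
lemma card_mul_increment {h : ℤ × ℤ → ℤ}
    (hh : ∀ a, h (a + (1, 0)) = h a + γ.flux (QuotientAddGroup.mk' L a, false) ∧
      h (a + (0, 1)) = h a + γ.flux (QuotientAddGroup.mk' L a, true))
    {l : ℤ × ℤ} (hl : l ∈ L) (a : ℤ × ℤ) :
    Fintype.card (TorusV L) * (h (a + l) - h a) = l.2 * w.1 - l.1 * w.2 := by
  have hp (a : ℤ × ℤ) : QuotientAddGroup.mk' L (a + l) = QuotientAddGroup.mk' L a := by
    rw [map_add, show QuotientAddGroup.mk' L l = 0 from (QuotientAddGroup.eq_zero_iff l).2 hl,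
      add_zero]
  let r : TorusV L → ℤ × ℤ := Function.surjInv (QuotientAddGroup.mk'_surjective L)
  have hr (x : TorusV L) : QuotientAddGroup.mk' L (r x) = x := Function.surjInv_eq _ x
  have hsum (b : Bool) (c : ℤ × ℤ) :
      ∑ x, γ.flux (QuotientAddGroup.mk' L (c + r x), b) = ∑ x, γ.flux (x, b) := by
    simp only [map_add, hr]
    exact Equiv.sum_comp (Equiv.addLeft (QuotientAddGroup.mk' L c)) fun x => γ.flux (x, b)
  have key (c : ℤ × ℤ) : ∑ x, h (c + r x) - ∑ x, h (r x) = c.2 * w.1 - c.1 * w.2 := by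
    refine plane_induction
      (S := fun c => ∑ x, h (c + r x) - ∑ x, h (r x) = c.2 * w.1 - c.1 * w.2) 0 (by simp)
      (fun c => ?_) (fun c => ?_) c
    · simp only [add_right_comm c _ (r _), (hh _).1, Finset.sum_add_distrib, hsum, γ.sum_flux.1,
        Prod.fst_add, Prod.snd_add]
      constructor <;> intro h <;> linear_combination h
    · simp only [add_right_comm c _ (r _), (hh _).2, Finset.sum_add_distrib, hsum, γ.sum_flux.2,
        Prod.fst_add, Prod.snd_add]
      constructor <;> intro h <;> linear_combination h
  rw [← key l, ← Finset.sum_sub_distrib, Finset.sum_congr rfl fun x _ => ?_, Finset.sum_const,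
    Finset.card_univ, nsmul_eq_mul]
  rw [add_comm l]
  exact plane_increment_const hh (fun a => by rw [hp]) (fun a => by rw [hp]) a (r x)

lemma potential_add (hw : w ∈ L) {h : ℤ × ℤ → ZMod 2}
    (hh : ∀ a, h (a + (1, 0)) = h a + γ.cochain (QuotientAddGroup.mk' L a, false) ∧
      h (a + (0, 1)) = h a + γ.cochain (QuotientAddGroup.mk' L a, true))
    {l : ℤ × ℤ} (hl : l ∈ L) (a : ℤ × ℤ) : ∃ c : ℤ,
    Fintype.card (TorusV L) * c = l.2 * w.1 - l.1 * w.2 ∧ h (a + l) = h a + c := by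
  obtain ⟨H, -, hH⟩ := exists_plane_primitive (fun a => γ.flux (QuotientAddGroup.mk' L a, false))
    (fun a => γ.flux (QuotientAddGroup.mk' L a, true)) (γ.flux_closed hw) a
  refine ⟨_, γ.card_mul_increment hH hl a, ?_⟩
  have key (c : ℤ × ℤ) : h c - H c = h a - H a := by
    refine plane_induction (S := fun c => h c - H c = h a - H a) a rfl
      (fun c => ?_) (fun c => ?_) c
    · rw [(hh c).1, (hH c).1, Int.cast_add, cast_flux, add_sub_add_right_eq_sub]
    · rw [(hh c).2, (hH c).2, Int.cast_add, cast_flux, add_sub_add_right_eq_sub]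
  rw [Int.cast_sub]
  linear_combination key (a + l)

lemma potential_add_self (hw : w ∈ L) {h : ℤ × ℤ → ZMod 2}
    (hh : ∀ a, h (a + (1, 0)) = h a + γ.cochain (QuotientAddGroup.mk' L a, false) ∧
      h (a + (0, 1)) = h a + γ.cochain (QuotientAddGroup.mk' L a, true)) (a : ℤ × ℤ) :
    h (a + w) = h a := by
  obtain ⟨c, hc, hca⟩ := γ.potential_add hw hh hw a
  rw [mul_comm w.2, sub_self, mul_eq_zero] at hc
  rw [hca, hc.resolve_left (Nat.cast_ne_zero.2 Fintype.card_ne_zero), Int.cast_zero, add_zero]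

lemma potential_add_one (hw : w ∈ L) {h : ℤ × ℤ → ZMod 2}
    (hh : ∀ a, h (a + (1, 0)) = h a + γ.cochain (QuotientAddGroup.mk' L a, false) ∧
      h (a + (0, 1)) = h a + γ.cochain (QuotientAddGroup.mk' L a, true))
    {l : ℤ × ℤ} (hl : l ∈ L)
    (hcard : (Fintype.card (TorusV L) : ℤ) = |l.2 * w.1 - l.1 * w.2|) (a : ℤ × ℤ) :
    h (a + l) = h a + 1 := by
  obtain ⟨c, hc, hca⟩ := γ.potential_add hw hh hl a
  have hc1 : |c| = 1 := by
    rw [← hc, abs_mul, Nat.abs_cast] at hcard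
    exact (mul_eq_left₀ (Nat.cast_ne_zero.2 Fintype.card_ne_zero)).1 hcard.symm
  rw [hca]
  rcases eq_or_eq_neg_of_abs_eq hc1 with rfl | rfl
  · rw [Int.cast_one]
  · rfl

end DualLoop

lemma isDualPair_cochain {w1 w2 : ℤ × ℤ} (hdet : w1.1 * w2.2 - w1.2 * w2.1 ≠ 0)
    {L : AddSubgroup (ℤ × ℤ)} (hL : L = AddSubgroup.closure {w1, w2}) [DecidableEq (TorusV L)]
    [Finite (TorusV L)] (γ10 : DualLoop L w1) (γ01 : DualLoop L w2) :
    IsDualPair (QuotientAddGroup.mk' L) w1 w2 γ10.cochain γ01.cochain := by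
  have := Fintype.ofFinite (TorusV L)
  have h1 : w1 ∈ L := hL ▸ AddSubgroup.subset_closure (by simp)
  have h2 : w2 ∈ L := hL ▸ AddSubgroup.subset_closure (by simp)
  have hcard := card_torusV hdet hL
  rw [Nat.card_eq_fintype_card] at hcard
  exact
  { surjective := QuotientAddGroup.mk'_surjective L
    mem_closure := fun a ha => hL ▸ (QuotientAddGroup.eq_zero_iff a).1 ha
    map_left := (QuotientAddGroup.eq_zero_iff w1).2 h1
    map_right := (QuotientAddGroup.eq_zero_iff w2).2 h2
    faceSum_left := γ10.faceSum_cochain h1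
    faceSum_right := γ01.faceSum_cochain h2
    class_add := fun pc hpc a => ⟨γ10.class_add h1 hpc a, γ01.class_add h2 hpc a⟩
    potential_left := fun h hh a => ⟨γ10.potential_add_self h1 hh a,
      γ10.potential_add_one h1 hh h2 (by rw [hcard]; congr 1; ring) a⟩
    potential_right := fun h hh a => ⟨γ01.potential_add_one h2 hh h1
      (by rw [hcard, ← abs_neg]; congr 1; ring) a, γ01.potential_add_self h2 hh a⟩ }

/-! ## The Ising expectation as a correlation of cochains -/

lemma sg_sum {ι : Type*} (s : Finset ι) (f : ι → ZMod 2) :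
    sg (∑ i ∈ s, f i) = ∏ i ∈ s, sg (f i) := by
  classical
  induction s using Finset.induction_on with
  | empty => simp
  | insert i s hi ih => rw [Finset.sum_insert hi, Finset.prod_insert hi, sg_add, ih]

lemma sg_natCast (k : ℕ) : sg k = (-1) ^ k := by
  induction k with
  | zero => simp
  | succ k ih => rw [Nat.cast_add, Nat.cast_one, sg_add, sg_one, ih, pow_succ]

/-- The spins `±1` as elements of `ZMod 2`. -/
def spinEquiv : ZMod 2 ≃ Bool where
  toFun a := decide (a = 0)
  invFun b := if b then 0 else 1
  left_inv := by decide
  right_inv := by decide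

lemma chi_spinEquiv (a : ZMod 2) : chi (spinEquiv a) = sg a := by
  simp [chi, sg, spinEquiv]

section Torus

open scoped Matrix

variable {L : AddSubgroup (ℤ × ℤ)} (κ : TorusV L → ZMod 2)

lemma chi_mul_chi (e : TorusV L × Bool) :
    chi (spinEquiv (κ e.1)) * chi (spinEquiv (κ (e.1 + edgeDir L e.2))) =
      sg (cob (QuotientAddGroup.mk' L) κ e) := by
  obtain ⟨x, b⟩ := e
  rw [chi_spinEquiv, chi_spinEquiv, ← sg_add]
  cases b <;> rfl

lemma cochain_of_mem_gammaSet [DecidableEq (TorusV L)] {w1 w2 : ℤ × ℤ} (h1 : w1 ∈ L) (h2 : w2 ∈ L)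
    (hw1 : w1 ≠ 0) (hw2 : w2 ≠ 0) (γ10 : DualLoop L w1) (γ01 : DualLoop L w2)
    (i j : Fin 2) (e : TorusV L × Bool) :
    (e ∈ gammaSet L (crossedEdges γ10) (crossedEdges γ01) i j →
      (((i : ℕ) : ZMod 2) • γ10.cochain + ((j : ℕ) : ZMod 2) • γ01.cochain) e = 1) ∧
    (e ∉ gammaSet L (crossedEdges γ10) (crossedEdges γ01) i j →
      (((i : ℕ) : ZMod 2) • γ10.cochain + ((j : ℕ) : ZMod 2) • γ01.cochain) e = 0) := by
  classical
  rw [Pi.add_apply, Pi.smul_apply, Pi.smul_apply, γ10.cochain_eq h1 hw1, γ01.cochain_eq h2 hw2,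
    gammaSet]
  fin_cases i <;> fin_cases j <;>
    by_cases h : e ∈ crossedEdges γ10 <;> by_cases h' : e ∈ crossedEdges γ01 <;>
    simp [Set.mem_symmDiff, h, h', CharTwo.add_self_eq_zero]

variable [Fintype (TorusV L)]

lemma torusEnergy_eq :
    torusEnergy L (fun x => spinEquiv (κ x)) = ∑ e, sg (cob (QuotientAddGroup.mk' L) κ e) := by
  rw [torusEnergy, finsum_eq_sum_of_fintype, Fintype.sum_prod_type]
  refine Finset.sum_congr rfl fun x _ => ?_
  rw [Fintype.sum_bool, ← chi_mul_chi, ← chi_mul_chi, add_comm]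
  rfl

lemma disorderWeight_mul_exp (E : Set (TorusV L × Bool)) (A : TorusV L × Bool → ZMod 2)
    (hA : ∀ e, (e ∈ E → A e = 1) ∧ (e ∉ E → A e = 0)) :
    disorderWeight L betaC E (fun x => spinEquiv (κ x)) *
      Real.exp (betaC * torusEnergy L (fun x => spinEquiv (κ x))) =
        wt (cob (QuotientAddGroup.mk' L) κ + A) := by
  classical
  rw [disorderWeight, ← Real.exp_add, wt, torusEnergy_eq]
  simp only [chi_mul_chi]
  rw [finsum_mem_def, finsum_eq_sum_of_fintype, mul_comm (-2), mul_assoc, ← mul_add,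
    Finset.mul_sum, ← Finset.sum_add_distrib]
  congr 2
  refine Finset.sum_congr rfl fun e _ => ?_
  rw [Pi.add_apply, sg_add, Set.indicator_apply]
  split_ifs with he
  · rw [(hA e).1 he, sg_one]; ring
  · rw [(hA e).2 he, sg_zero]; ring

variable [DecidableEq (TorusV L)]

lemma spinProd_eq {n : ℕ} (v : Fin n → TorusV L) :
    spinProd L v (fun x => spinEquiv (κ x)) = sg ((∑ k, Pi.single (v k) 1) ⬝ᵥ κ) := by
  rw [sum_dotProduct, sg_sum, spinProd]
  refine Finset.prod_congr rfl fun k _ => ?_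
  rw [single_dotProduct, one_mul, chi_spinEquiv]

lemma finsum_spinProd_mul_muPQ {w1 w2 : ℤ × ℤ} (h1 : w1 ∈ L) (h2 : w2 ∈ L)
    (hw1 : w1 ≠ 0) (hw2 : w2 ≠ 0) (γ10 : DualLoop L w1) (γ01 : DualLoop L w2)
    {n : ℕ} (v : Fin n → TorusV L) (p q : Fin 2) :
    ∑ᶠ σ : TorusV L → Bool, spinProd L v σ *
      muPQ L betaC (crossedEdges γ10) (crossedEdges γ01) p q σ *
        Real.exp (betaC * torusEnergy L σ) =
    1 / 4 * corr (QuotientAddGroup.mk' L) γ10.cochain γ01.cochain (∑ k, Pi.single (v k) 1)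
      ((1 - (p : ℕ) : ℕ) : ZMod 2) ((1 - (q : ℕ) : ℕ) : ZMod 2) 0 0 := by
  have hsum (f : ZMod 2 → ℝ) : ∑ i, f i = ∑ i : Fin 2, f ((i : ℕ) : ZMod 2) := by
    rw [Fin.sum_univ_two, Fin.val_zero, Fin.val_one, Nat.cast_zero, Nat.cast_one]
    exact Fin.sum_univ_two f
  have hcomm (f : Fin 2 → Fin 2 → (TorusV L → ZMod 2) → ℝ) :
      ∑ i, ∑ j, ∑ κ, f i j κ = ∑ κ, ∑ i, ∑ j, f i j κ := by
    rw [Finset.sum_comm (s := Finset.univ (α := TorusV L → ZMod 2))]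
    exact Finset.sum_congr rfl fun i _ => Finset.sum_comm
  rw [← finsum_comp_equiv (Equiv.arrowCongr (Equiv.refl (TorusV L)) spinEquiv),
    finsum_eq_sum_of_fintype, corr, hsum]
  simp only [hsum]
  rw [hcomm, Finset.mul_sum]
  refine Finset.sum_congr rfl fun κ _ => ?_
  rw [show (Equiv.refl (TorusV L)).arrowCongr spinEquiv κ = fun x => spinEquiv (κ x) from rfl,
    spinProd_eq, muPQ]
  simp only [Finset.mul_sum, Finset.sum_mul]
  refine Finset.sum_congr rfl fun i _ => Finset.sum_congr rfl fun j _ => ?_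
  rw [zero_dotProduct, add_zero, add_zero, add_assoc (cob _ κ), ← disorderWeight_mul_exp κ _ _
    (cochain_of_mem_gammaSet h1 h2 hw1 hw2 γ10 γ01 i j), sg_add, ← sg_natCast]
  push_cast
  ring

end Torus

/-- **Non-vanishing of spin correlations with topological disorder insertions**
(Lemma 2.6): for any discrete torus, simple dual loops `γ₁₀, γ₀₁` in the homology
classes of the two periods intersecting at a single dual vertex, any even `n > 0`,
pairwise distinct vertices `v₁, …, vₙ` and any `(p,q) ∈ {0,1}²`, one has
`E[σ_{v₁} ⋯ σ_{vₙ} μ^{(p,q)}] ≠ 0`. -/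
theorem spin_disorder_correlation_ne_zero
    (w1 w2 : ℤ × ℤ) (hdet : w1.1 * w2.2 - w1.2 * w2.1 ≠ 0)
    (L : AddSubgroup (ℤ × ℤ)) (hL : L = AddSubgroup.closure {w1, w2})
    (hfin : Finite (TorusV L))
    (γ10 : DualLoop L w1) (γ01 : DualLoop L w2)
    (hmeet : singleIntersection γ10 γ01)
    (n : ℕ) (hn : Even n) (hpos : 0 < n)
    (v : Fin n → TorusV L) (hv : Function.Injective v)
    (p q : Fin 2) :
    torusExp L betaC
      (fun σ => spinProd L v σ *
        muPQ L betaC (crossedEdges γ10) (crossedEdges γ01) p q σ) ≠ 0 := by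
  classical
  have := Fintype.ofFinite (TorusV L)
  have h1 : w1 ∈ L := hL ▸ AddSubgroup.subset_closure (by simp)
  have h2 : w2 ∈ L := hL ▸ AddSubgroup.subset_closure (by simp)
  have hw1 : w1 ≠ 0 := by rintro rfl; simp at hdet
  have hw2 : w2 ≠ 0 := by rintro rfl; simp at hdet
  rw [torusExp, finsum_spinProd_mul_muPQ h1 h2 hw1 hw2, finsum_eq_sum_of_fintype]
  refine div_ne_zero (mul_ne_zero (by norm_num)
    (corr_ne_zero (isDualPair_cochain hdet hL γ10 γ01) ?_ ?_))
    (Finset.sum_pos (fun _ _ => Real.exp_pos _) Finset.univ_nonempty).ne'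
  · simp only [Finset.sum_apply]
    rw [Finset.sum_comm]
    simpa using (CharP.cast_eq_zero_iff (ZMod 2) 2 n).2 hn.two_dvd
  · refine Function.ne_iff.2 ⟨v ⟨0, hpos⟩, ?_⟩
    rw [Finset.sum_apply, Finset.sum_eq_single ⟨0, hpos⟩
      (fun k _ hk => Pi.single_eq_of_ne (hv.ne hk.symm) _) (by simp), Pi.single_eq_same]
    exact one_ne_zero

end
end

section
/- Rigidity of s-holomorphic functions on the discrete torus (core of Lemma 2.4): Let F be an s-holomorphic function on the corners of a discrete torus 𝕋^δ such that for every dual vertex u ∈ 𝕋^{δ,⋆}, Σ_{c ∼ u} η_c² F(c) = 0, where the sum is over the four corners c adjacent to u. Then there exists a constant c₀ ∈ ℂ such that F(c) = Proj_{η_c}(c₀) for every corner c. -/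
noncomputable section

open Complex Filter Topology

/-- The (squares of the) corner factors `η_c = e^{iπ/4}((c• − c°)/|c• − c°|)^{-1/2}`
for the four corner types around a lattice vertex, indexed so that the `k`-th corner of
the vertex `x` points towards the dual vertex `x + (½,½) − offset k`. -/
def etaC : Fin 4 → ℂ :=
  ![1, Complex.exp (-(Real.pi * Complex.I) / 4), Complex.I,
    Complex.exp (Real.pi * Complex.I / 4)]

/-- Orthogonal projection of `x` onto the line `ℝη`. -/
def projLine (η x : ℂ) : ℂ := (x + η ^ 2 * (starRingEnd ℂ) x) / 2

/-- The lattice vertex carrying the `k`-th corner around the dual vertex `u` is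
`u + cornerVertexOff k`. -/
def cornerVertexOff (L : AddSubgroup (ℤ × ℤ)) : Fin 4 → TorusV L :=
  ![QuotientAddGroup.mk ((0, 0) : ℤ × ℤ), QuotientAddGroup.mk ((1, 0) : ℤ × ℤ),
    QuotientAddGroup.mk ((1, 1) : ℤ × ℤ), QuotientAddGroup.mk ((0, 1) : ℤ × ℤ)]

/-- S-holomorphicity of a function on the corners of the discrete torus: around each
primal edge (horizontal or vertical) with its crossing dual edge there is a single
complex number `W` whose projections give the values at the four surrounding corners. -/
def SHoloTorus (L : AddSubgroup (ℤ × ℤ)) (F : TorusV L × Fin 4 → ℂ) : Prop :=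
  (∀ x : TorusV L, ∃ W : ℂ,
      F (x, 0) = projLine (etaC 0) W ∧ F (x + e1 L, 1) = projLine (etaC 1) W ∧
      F (x + e1 L, 2) = projLine (etaC 2) W ∧ F (x, 3) = projLine (etaC 3) W) ∧
  (∀ x : TorusV L, ∃ W : ℂ,
      F (x, 0) = projLine (etaC 0) W ∧ F (x, 1) = projLine (etaC 1) W ∧
      F (x + e2 L, 2) = projLine (etaC 2) W ∧ F (x + e2 L, 3) = projLine (etaC 3) W)

theorem etaC_sq (k : Fin 4) : (etaC k) ^ 2 = ![1, -I, -1, I] k := by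
  have h : Complex.exp (Real.pi * I / 2) = I := by
    rw [show (Real.pi * I / 2 : ℂ) = Real.pi / 2 * I by ring, Complex.exp_pi_div_two_mul_I]
  fin_cases k
  · simp [etaC]
  · simp [etaC, ← Complex.exp_nat_mul]
    rw [show (2 * (-(Real.pi * I) / 4) : ℂ) = -(Real.pi * I / 2) by ring, Complex.exp_neg, h,
      Complex.inv_I]
  · simp [etaC]
  · simp [etaC, ← Complex.exp_nat_mul]
    rw [show (2 * (Real.pi * I / 4) : ℂ) = Real.pi * I / 2 by ring, h]

theorem projLine_etaC_one (W : ℂ) : projLine (etaC 1) W =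
    (1 - I) / 2 * (projLine (etaC 0) W + I * projLine (etaC 2) W) := by
  simp only [projLine, etaC_sq]
  simp
  linear_combination (W - starRingEnd ℂ W) / 4 * I_sq

theorem projLine_etaC_three (W : ℂ) : projLine (etaC 3) W =
    (1 + I) / 2 * (projLine (etaC 0) W - I * projLine (etaC 2) W) := by
  simp only [projLine, etaC_sq]
  simp
  linear_combination (W - starRingEnd ℂ W) / 4 * I_sq

/-- A function on the torus invariant under both unit translations is constant. -/
theorem TorusV.eq_zero_of_invariant {α : Type*} (L : AddSubgroup (ℤ × ℤ)) (g : TorusV L → α)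
    (h1 : ∀ x, g (x + e1 L) = g x) (h2 : ∀ x, g (x + e2 L) = g x) (x : TorusV L) :
    g x = g 0 := by
  have zsmul_invariant : ∀ e : TorusV L, (∀ y, g (y + e) = g y) →
      ∀ (n : ℤ) (y : TorusV L), g (y + n • e) = g y := by
    intro e he n
    induction n with
    | zero => simp
    | succ n ih => intro y; rw [add_zsmul, one_zsmul, ← add_assoc, he, ih]
    | pred n ih =>
      intro y
      rw [← he, sub_zsmul, one_zsmul, add_assoc, neg_add_cancel_right, ih]
  induction x using QuotientAddGroup.induction_on with
  | H z =>
    obtain ⟨m, n⟩ := z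
    have hz : (QuotientAddGroup.mk (m, n) : TorusV L) = 0 + m • e1 L + n • e2 L := by
      rw [e1, e2, ← QuotientAddGroup.mk_zsmul, ← QuotientAddGroup.mk_zsmul, zero_add,
        ← QuotientAddGroup.mk_add]
      simp
    rw [hz, zsmul_invariant _ h2, zsmul_invariant _ h1]

/-- **Rigidity of s-holomorphic functions on the discrete torus** (core of Lemma 2.4):
if `F` is s-holomorphic on the corners of a discrete torus and for every dual vertex `u`
the sum `Σ_{c ∼ u} η_c² F(c)` over the four adjacent corners vanishes, then
`F(c) = Proj_{η_c}(c₀)` for a single constant `c₀ ∈ ℂ`. -/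
theorem sholomorphic_rigidity_torus
    (w1 w2 : ℤ × ℤ) (hdet : w1.1 * w2.2 - w1.2 * w2.1 ≠ 0)
    (L : AddSubgroup (ℤ × ℤ)) (hL : L = AddSubgroup.closure {w1, w2})
    (F : TorusV L × Fin 4 → ℂ)
    (hshol : SHoloTorus L F)
    (hsum : ∀ u : TorusV L,
      ∑ k : Fin 4, (etaC k) ^ 2 * F (u + cornerVertexOff L k, k) = 0) :
    ∃ c₀ : ℂ, ∀ (x : TorusV L) (k : Fin 4), F (x, k) = projLine (etaC k) c₀ := by
  obtain ⟨hH, hV⟩ := hshol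
  have b1 (x) : F (x + e1 L, 1) = (1 - I) / 2 * (F (x, 0) + I * F (x + e1 L, 2)) := by
    obtain ⟨W, h0, h1, h2, -⟩ := hH x
    rw [h0, h1, h2, projLine_etaC_one]
  have d1 (x) : F (x, 3) = (1 + I) / 2 * (F (x, 0) - I * F (x + e1 L, 2)) := by
    obtain ⟨W, h0, -, h2, h3⟩ := hH x
    rw [h0, h2, h3, projLine_etaC_three]
  have b2 (x) : F (x, 1) = (1 - I) / 2 * (F (x, 0) + I * F (x + e2 L, 2)) := by
    obtain ⟨W, h0, h1, h2, -⟩ := hV x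
    rw [h0, h1, h2, projLine_etaC_one]
  have d2 (x) : F (x + e2 L, 3) = (1 + I) / 2 * (F (x, 0) - I * F (x + e2 L, 2)) := by
    obtain ⟨W, h0, -, h2, h3⟩ := hV x
    rw [h0, h2, h3, projLine_etaC_three]
  have hs (u) : F (u, 0) - I * F (u + e1 L, 1) - F (u + e1 L + e2 L, 2)
      + I * F (u + e2 L, 3) = 0 := by
    have hu := hsum u
    have h00 : (QuotientAddGroup.mk ((0, 0) : ℤ × ℤ) : TorusV L) = 0 := rfl
    have h11 : (QuotientAddGroup.mk ((1, 1) : ℤ × ℤ) : TorusV L) = e1 L + e2 L := rfl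
    have h10 : (QuotientAddGroup.mk ((1, 0) : ℤ × ℤ) : TorusV L) = e1 L := rfl
    have h01 : (QuotientAddGroup.mk ((0, 1) : ℤ × ℤ) : TorusV L) = e2 L := rfl
    simp only [Fin.sum_univ_four, etaC_sq, cornerVertexOff, h00, h11, h10, h01] at hu
    simp [← add_assoc] at hu
    linear_combination hu
  have F2_imag (x) : starRingEnd ℂ (F (x, 2)) = -F (x, 2) := by
    obtain ⟨W, -, -, h2, -⟩ := hH (x - e1 L)
    rw [sub_add_cancel] at h2
    simp [h2, projLine, etaC_sq, map_ofNat]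
    ring
  have key (u) : (1 - I) * F (u + e1 L, 2) + (1 + I) * F (u + e2 L, 2)
      = 2 * F (u + e1 L + e2 L, 2) := by
    linear_combination 2 * hs u + 2 * I * b1 u - 2 * I * d2 u +
      ((1 - I) * F (u + e1 L, 2) + (1 + I) * F (u + e2 L, 2) - 2 * F (u, 0)) * I_sq
  have key_conj (u) : (1 + I) * F (u + e1 L, 2) + (1 - I) * F (u + e2 L, 2)
      = 2 * F (u + e1 L + e2 L, 2) := by
    have h := congrArg (starRingEnd ℂ) (key u)
    simp only [map_add, map_sub, map_mul, map_one, map_ofNat, conj_I, F2_imag] at h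
    linear_combination -h
  have F2_diag (u) : F (u + e1 L, 2) = F (u + e2 L, 2) := by
    have h : 2 * I * (F (u + e1 L, 2) - F (u + e2 L, 2)) = 0 := by
      linear_combination key_conj u - key u
    simpa [sub_eq_zero] using h
  have F2_corner (u) : F (u + e1 L + e2 L, 2) = F (u + e1 L, 2) := by
    linear_combination -1 / 2 * key u - (1 + I) / 2 * F2_diag u
  have F2_e2 (x) : F (x + e2 L, 2) = F (x, 2) := by
    simpa using F2_corner (x - e1 L)
  have F2_e1 (x) : F (x + e1 L, 2) = F (x, 2) := by rw [F2_diag, F2_e2]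
  have F0_e1 (x) : F (x + e1 L, 0) = F (x, 0) := by
    have h := b2 (x + e1 L)
    rw [b1, F2_e2] at h
    linear_combination -(1 + I) * h + (F (x + e1 L, 0) - F (x, 0)) / 2 * I_sq
  have F0_e2 (x) : F (x + e2 L, 0) = F (x, 0) := by
    have h := d1 (x + e2 L)
    rw [d2, F2_e1] at h
    linear_combination -(1 - I) * h + (F (x + e2 L, 0) - F (x, 0)) / 2 * I_sq
  have F0_const := TorusV.eq_zero_of_invariant L (fun x => F (x, 0)) F0_e1 F0_e2
  have F2_const := TorusV.eq_zero_of_invariant L (fun x => F (x, 2)) F2_e1 F2_e2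
  obtain ⟨W, h0, -, h2, -⟩ := hH 0
  rw [F2_e1] at h2
  refine ⟨W, fun x k => ?_⟩
  fin_cases k
  · exact (F0_const x).trans h0
  · have h := b2 x
    rw [F2_e2, show F (x, 0) = _ from F0_const x, show F (x, 2) = _ from F2_const x, h0, h2,
      ← projLine_etaC_one] at h
    exact h
  · exact (F2_const x).trans h2
  · have h := d1 x
    rw [F2_e1, show F (x, 0) = _ from F0_const x, show F (x, 2) = _ from F2_const x, h0, h2,
      ← projLine_etaC_three] at h
    exact h

end
end

section
/- Rigidity of elliptic functions with simple poles with residues on a half-ray (the uniqueness argument in Theorem 2.8): Let ω₁, ω₂ ∈ ℂ∖{0} with Im(ω₂/ω₁) > 0, and let f be a meromorphic function on ℂ satisfying f(z + ω₁) = f(z) and f(z + ω₂) = f(z). Suppose that every pole of f is simple and that the residue of f at each pole lies in i·[0,∞) (i.e. equals i c² for some real c). Then f has no poles and is constant. -/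
open Filter Topology

theorem Complex.exists_tendsto_of_tendsto_sub_mul_zero {f : ℂ → ℂ} {c : ℂ}
    (hd : ∀ᶠ z in 𝓝[≠] c, DifferentiableAt ℂ f z)
    (h0 : Tendsto (fun z => (z - c) * f z) (𝓝[≠] c) (𝓝 0)) :
    ∃ l, Tendsto f (𝓝[≠] c) (𝓝 l) := by
  refine ⟨_, Complex.tendsto_limUnder_of_differentiable_on_punctured_nhds_of_isLittleO hd ?_⟩
  rw [Asymptotics.isLittleO_iff_tendsto']
  · have h1 : Tendsto (fun z : ℂ => (z - c) * f c) (𝓝[≠] c) (𝓝 0) := by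
      have : ContinuousAt (fun z : ℂ => (z - c) * f c) c := by fun_prop
      simpa using this.tendsto.mono_left nhdsWithin_le_nhds
    refine (by simpa using h0.sub h1 : Tendsto _ _ _).congr fun z => ?_
    rw [div_inv_eq_mul]; ring
  · filter_upwards [self_mem_nhdsWithin] with z hz h
    exact absurd (inv_eq_zero.1 h) (sub_ne_zero.2 hz)

theorem circleIntegral_sub_circleIntegral_eq_sum_residues (s : Finset ℂ) (ρ : ℂ → ℂ) {r R : ℝ}
    (hr : 0 < r) (hrR : r ≤ R) (H : ℂ → ℂ)
    (hs : ∀ a ∈ s, r < ‖a‖ ∧ ‖a‖ < R)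
    (hd : ∀ z, r ≤ ‖z‖ → ‖z‖ ≤ R → z ∉ s → DifferentiableAt ℂ H z)
    (hres : ∀ a ∈ s, Tendsto (fun z => (z - a) * H z) (𝓝[≠] a) (𝓝 (ρ a))) :
    (∮ z in C(0, R), H z) - (∮ z in C(0, r), H z) =
      2 * Real.pi * Complex.I * ∑ a ∈ s, ρ a := by
  induction s using Finset.induction_on generalizing H with
  | empty =>
    have hd' : ∀ z ∈ Metric.closedBall (0 : ℂ) R \ Metric.ball 0 r, DifferentiableAt ℂ H z := by
      intro z hz
      simp only [Set.mem_sdiff, Metric.mem_closedBall, dist_zero_right, Metric.mem_ball,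
        not_lt] at hz
      exact hd z hz.2 hz.1 (by simp)
    rw [Complex.circleIntegral_eq_of_differentiable_on_annulus_off_countable hr hrR
      Set.countable_empty (fun z hz => (hd' z hz).continuousAt.continuousWithinAt)]
    · simp
    · intro z hz
      exact hd' z ⟨Metric.ball_subset_closedBall hz.1.1,
        fun h => hz.1.2 (Metric.ball_subset_closedBall h)⟩
  | insert a s ha ih =>
    have haR := hs a (Finset.mem_insert_self _ _)
    have hfar : ∀ᶠ z in 𝓝[≠] a, r ≤ ‖z‖ ∧ ‖z‖ ≤ R ∧ z ∉ insert a s := by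
      have h1 : ∀ᶠ z : ℂ in 𝓝 a, r < ‖z‖ ∧ ‖z‖ < R :=
        (continuous_norm.tendsto a).eventually (isOpen_Ioo.mem_nhds haR)
      have h2 : ∀ᶠ z : ℂ in 𝓝 a, z ∉ s :=
        s.finite_toSet.isClosed.isOpen_compl.mem_nhds (by simpa using ha)
      filter_upwards [nhdsWithin_le_nhds h1, nhdsWithin_le_nhds h2, self_mem_nhdsWithin]
        with z h1 h2 h3
      exact ⟨h1.1.le, h1.2.le, by simpa using ⟨h3, h2⟩⟩
    set p : ℂ → ℂ := fun z => ρ a * (z - a)⁻¹ with hp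
    have hpd : ∀ z, z ≠ a → DifferentiableAt ℂ p z := fun z hz => by
      have := sub_ne_zero.2 hz
      fun_prop (disch := assumption)
    obtain ⟨l, hl⟩ : ∃ l, Tendsto (fun z => H z - p z) (𝓝[≠] a) (𝓝 l) := by
      refine Complex.exists_tendsto_of_tendsto_sub_mul_zero ?_ ?_
      · filter_upwards [hfar, self_mem_nhdsWithin] with z hz hza
        exact (hd z hz.1 hz.2.1 hz.2.2).sub (hpd z hza)
      · have := (hres a (Finset.mem_insert_self _ _)).sub_const (ρ a)
        rw [sub_self] at this
        refine this.congr' ?_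
        filter_upwards [self_mem_nhdsWithin] with z hz
        have := sub_ne_zero.2 hz
        simp only [hp]
        field_simp
    set K : ℂ → ℂ := Function.update (fun z => H z - p z) a l with hK
    have hKe : ∀ z, z ≠ a → K =ᶠ[𝓝 z] fun z => H z - p z := fun z hz => by
      filter_upwards [isOpen_ne.mem_nhds hz] with w hw
      exact Function.update_of_ne hw _ _
    have hKd : ∀ z, r ≤ ‖z‖ → ‖z‖ ≤ R → z ∉ s → DifferentiableAt ℂ K z := by
      intro z h1 h2 h3
      by_cases hza : z = a
      · subst hza
        refine (Complex.analyticAt_of_differentiable_on_punctured_nhds_of_continuousAt ?_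
          (continuousAt_update_same.2 hl)).differentiableAt
        filter_upwards [hfar, self_mem_nhdsWithin] with w hw hwa
        exact ((hd w hw.1 hw.2.1 hw.2.2).sub (hpd w hwa)).congr_of_eventuallyEq (hKe w hwa)
      · exact ((hd z h1 h2 (by simp [hza, h3])).sub (hpd z hza)).congr_of_eventuallyEq (hKe z hza)
    have hKres : ∀ b ∈ s, Tendsto (fun z => (z - b) * K z) (𝓝[≠] b) (𝓝 (ρ b)) := by
      intro b hb
      have hba : b ≠ a := fun h => ha (h ▸ hb)
      have h1 : Tendsto (fun z => (z - b) * p z) (𝓝[≠] b) (𝓝 0) := by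
        have : ContinuousAt (fun z => (z - b) * p z) b :=
          (by fun_prop : ContinuousAt (fun z => z - b) b).mul (hpd b hba).continuousAt
        simpa using this.tendsto.mono_left nhdsWithin_le_nhds
      have h2 := (hres b (Finset.mem_insert_of_mem hb)).sub h1
      rw [sub_zero] at h2
      refine h2.congr' ?_
      filter_upwards [nhdsWithin_le_nhds (hKe b hba)] with z hz
      rw [hz]; ring
    have key := ih K (fun b hb => hs b (Finset.mem_insert_of_mem hb)) hKd hKres
    have hcirc : ∀ x : ℝ, 0 < x → r ≤ x → x ≤ R → x ≠ ‖a‖ → (∀ b ∈ s, x ≠ ‖b‖) →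
        (∮ z in C(0, x), K z) = (∮ z in C(0, x), H z) - ρ a * ∮ z in C(0, x), (z - a)⁻¹ := by
      intro x hx hrx hxR hxa hxs
      have hne : ∀ z ∈ Metric.sphere (0 : ℂ) x, z ≠ a := by
        rintro z hz rfl
        exact hxa (by simpa using hz.symm)
      rw [← circleIntegral.integral_const_mul, ← circleIntegral.integral_sub]
      · refine circleIntegral.integral_congr hx.le fun z hz => ?_
        exact Function.update_of_ne (hne z hz) _ _
      · refine ContinuousOn.circleIntegrable hx.le fun z hz => ?_
        have hz' : ‖z‖ = x := by simpa using hz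
        refine (hd z (by linarith) (by linarith) ?_).continuousAt.continuousWithinAt
        rw [Finset.mem_insert, not_or]
        exact ⟨hne z hz, fun h => hxs z h hz'.symm⟩
      · exact ContinuousOn.circleIntegrable hx.le fun z hz =>
          (hpd z (hne z hz)).continuousAt.continuousWithinAt
    have hs' := fun b hb => hs b (Finset.mem_insert_of_mem hb)
    rw [hcirc R (by linarith) hrR le_rfl haR.2.ne' (fun b hb => (hs' b hb).2.ne'),
      hcirc r hr le_rfl hrR haR.1.ne (fun b hb => (hs' b hb).1.ne),
      circleIntegral.integral_sub_inv_of_mem_ball (by simpa using haR.2),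
      Complex.circleIntegral_eq_zero_of_differentiable_on_off_countable (f := fun z => (z - a)⁻¹)
        hr.le Set.countable_empty] at key
    · rw [Finset.sum_insert ha, mul_add, ← key]; ring
    · intro z hz
      have : z - a ≠ 0 := by
        rintro h
        rw [sub_eq_zero.1 h] at hz
        simp at hz; linarith
      exact ContinuousAt.continuousWithinAt (by fun_prop (disch := assumption))
    · intro z hz
      have : z - a ≠ 0 := by
        rintro h
        rw [sub_eq_zero.1 h] at hz
        simp at hz; linarith
      fun_prop (disch := assumption)

theorem circleIntegral_inv_mul_eq_of_mul_invariant {G : ℂ → ℂ} {q : ℂ} (hq : q ≠ 0)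
    (hG : ∀ z, z ≠ 0 → G (q * z) = G z) {R : ℝ} (hR : 0 < R) :
    (∮ z in C(0, ‖q‖ * R), z⁻¹ * G z) = ∮ z in C(0, R), z⁻¹ * G z := by
  have h : ∀ x : ℝ, 0 < x → (∮ z in C(0, x), z⁻¹ * G z) =
      ∫ θ in (0 : ℝ)..(2 * Real.pi), Complex.I * G (circleMap 0 x θ) := by
    intro x hx
    refine intervalIntegral.integral_congr fun θ _ => ?_
    have : circleMap 0 x θ ≠ 0 := circleMap_ne_center hx.ne'
    simp only [deriv_circleMap, smul_eq_mul]
    field_simp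
  have hrot : ∀ θ : ℝ, G (circleMap 0 (‖q‖ * R) (q.arg + θ)) = G (circleMap 0 R θ) := by
    intro θ
    rw [← hG _ (circleMap_ne_center hR.ne')]
    congr 1
    conv_rhs => rw [← Complex.norm_mul_exp_arg_mul_I q]
    simp only [circleMap, zero_add]
    push_cast
    rw [add_mul, Complex.exp_add]
    ring
  rw [h _ hR, h _ (mul_pos (norm_pos_iff.2 hq) hR)]
  simp only [← hrot]
  rw [intervalIntegral.integral_comp_add_left
    (fun θ => Complex.I * G (circleMap 0 (‖q‖ * R) θ))]
  have hp : Function.Periodic (fun θ => Complex.I * G (circleMap 0 (‖q‖ * R) θ))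
      (2 * Real.pi) := fun θ => by
    simp only [periodic_circleMap 0 (‖q‖ * R) θ]
  simpa using hp.intervalIntegral_add_eq 0 q.arg

theorem differentiableAt_of_mul_invariant_of_residues_on_ray {G : ℂ → ℂ} {q u : ℂ} (hq : q ≠ 0)
    (hq1 : ‖q‖ < 1) (hu : u ≠ 0) (hG : ∀ z, z ≠ 0 → G (q * z) = G z)
    (hdisc : ∀ a, a ≠ 0 → ∀ᶠ z in 𝓝[≠] a, DifferentiableAt ℂ G z)
    (hres : ∀ a, a ≠ 0 → ¬ DifferentiableAt ℂ G a → ∃ t : ℝ, 0 < t ∧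
      Tendsto (fun z => (z - a) * (z⁻¹ * G z)) (𝓝[≠] a) (𝓝 (u * t))) :
    ∀ a, a ≠ 0 → DifferentiableAt ℂ G a := by
  intro a ha
  by_contra hnd
  have hq0 : 0 < ‖q‖ := norm_pos_iff.2 hq
  have ha0 : 0 < ‖a‖ := norm_pos_iff.2 ha
  set S : Set ℂ := {z | ¬ DifferentiableAt ℂ G z ∧ ‖q‖ * ‖a‖ ≤ ‖z‖ ∧ ‖q‖ * ‖z‖ ≤ ‖a‖} with hS
  have hSfin : S.Finite := by
    by_contra hinf
    have hK : IsCompact {z : ℂ | ‖q‖ * ‖a‖ ≤ ‖z‖ ∧ ‖q‖ * ‖z‖ ≤ ‖a‖} := by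
      refine (isCompact_closedBall (0 : ℂ) (‖a‖ / ‖q‖)).of_isClosed_subset ?_ ?_
      · exact (isClosed_le continuous_const continuous_norm).inter
          (isClosed_le (continuous_const.mul continuous_norm) continuous_const)
      · intro z hz
        rw [mem_closedBall_zero_iff, le_div_iff₀ hq0, mul_comm]
        exact hz.2
    obtain ⟨x, hx, hacc⟩ := Set.Infinite.exists_accPt_of_subset_isCompact hinf hK
      fun z hz => hz.2
    rw [accPt_iff_frequently_nhdsNE] at hacc
    have hx0 : x ≠ 0 := norm_pos_iff.1 ((mul_pos hq0 ha0).trans_le hx.1)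
    exact hacc ((hdisc x hx0).mono fun z hz h => h.1 hz)
  obtain ⟨R, hR, hRS⟩ : ∃ R ∈ Set.Ioo ‖a‖ (‖a‖ / ‖q‖),
      R ∉ (fun z => ‖z‖) '' S ∪ (fun z => ‖z‖ / ‖q‖) '' S :=
    (Set.Ioo_infinite (by rw [lt_div_iff₀ hq0]; nlinarith)).exists_notMem_finite
      ((hSfin.image _).union (hSfin.image _))
  have hR0 : 0 < R := ha0.trans hR.1
  have hqR : ‖q‖ * R < ‖a‖ := by
    have := hR.2
    rwa [lt_div_iff₀ hq0, mul_comm] at this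
  simp only [Set.mem_union, Set.mem_image, not_or, not_exists, not_and] at hRS
  set s := hSfin.toFinset.filter fun z => ‖q‖ * R < ‖z‖ ∧ ‖z‖ < R with hs
  have hmem : ∀ z, ‖q‖ * R ≤ ‖z‖ → ‖z‖ ≤ R → ¬ DifferentiableAt ℂ G z → z ∈ s := by
    intro z h1 h2 h3
    have hzS : z ∈ S := ⟨h3, by nlinarith [hR.1], by nlinarith⟩
    simp only [hs, Finset.mem_filter, Set.Finite.mem_toFinset]
    refine ⟨hzS, lt_of_le_of_ne h1 fun h => hRS.2 z hzS ?_, lt_of_le_of_ne h2 (hRS.1 z hzS)⟩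
    rw [← h]; field_simp
  have has : a ∈ s := hmem a hqR.le hR.1.le hnd
  have hs0 : ∀ z ∈ s, z ≠ 0 ∧ ¬ DifferentiableAt ℂ G z := by
    intro z hz
    simp only [hs, Finset.mem_filter, Set.Finite.mem_toFinset] at hz
    exact ⟨norm_pos_iff.1 ((mul_pos hq0 hR0).trans hz.2.1), hz.1.1⟩
  have hex : ∀ z, ∃ t : ℝ, z ∈ s → 0 < t ∧
      Tendsto (fun w => (w - z) * (w⁻¹ * G w)) (𝓝[≠] z) (𝓝 (u * t)) := by
    intro z
    by_cases hz : z ∈ s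
    · obtain ⟨t, ht⟩ := hres z (hs0 z hz).1 (hs0 z hz).2
      exact ⟨t, fun _ => ht⟩
    · exact ⟨0, fun h => absurd h hz⟩
  choose t ht using hex
  have key := circleIntegral_sub_circleIntegral_eq_sum_residues s (fun z => u * t z)
    (mul_pos hq0 hR0) (by nlinarith : ‖q‖ * R ≤ R) (fun z => z⁻¹ * G z)
    (fun z hz => (Finset.mem_filter.1 hz).2)
    (fun z h1 h2 h3 => (differentiableAt_inv
      (norm_pos_iff.1 ((mul_pos hq0 hR0).trans_le h1))).mul
        (not_not.1 fun h => h3 (hmem z h1 h2 h)))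
    (fun z hz => (ht z hz).2)
  rw [circleIntegral_inv_mul_eq_of_mul_invariant hq hG hR0, sub_self, ← Finset.mul_sum,
    ← Complex.ofReal_sum] at key
  have hpos : 0 < ∑ z ∈ s, t z := Finset.sum_pos (fun z hz => (ht z hz).1) ⟨a, has⟩
  have : (2 * Real.pi * Complex.I * (u * ((∑ z ∈ s, t z : ℝ) : ℂ)) : ℂ) ≠ 0 :=
    mul_ne_zero Complex.two_pi_I_ne_zero (mul_ne_zero hu (Complex.ofReal_ne_zero.2 hpos.ne'))
  exact this key.symm

theorem HasStrictDerivAt.nhdsNE_le_map {f : ℂ → ℂ} {f' z : ℂ} (h : HasStrictDerivAt f f' z)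
    (hf' : f' ≠ 0) : 𝓝[≠] (f z) ≤ map f (𝓝[≠] z) := by
  intro s hs
  rw [mem_map, mem_nhdsWithin_iff_eventually] at hs
  rw [mem_nhdsWithin_iff_eventually, ← h.map_nhds_eq hf', eventually_map]
  filter_upwards [hs] with w hw hne
  exact hw fun h => hne (congrArg f h)

theorem differentiable_of_periods_one_of_residues_on_ray {g : ℂ → ℂ} {τ u : ℂ} (hτ : 0 < τ.im)
    (hu : u ≠ 0) (hg1 : Function.Periodic g 1) (hgτ : Function.Periodic g τ)
    (hdisc : ∀ z, ∀ᶠ w in 𝓝[≠] z, DifferentiableAt ℂ g w)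
    (hres : ∀ z, ¬ DifferentiableAt ℂ g z → ∃ t : ℝ, 0 < t ∧
      Tendsto (fun w => (w - z) * g w) (𝓝[≠] z) (𝓝 (u * t))) :
    Differentiable ℂ g := by
  have hg1' : Function.Periodic g ((1 : ℝ) : ℂ) := by simpa using hg1
  set Q : ℂ → ℂ := Function.Periodic.qParam 1 with hQ
  set G : ℂ → ℂ := Function.Periodic.cuspFunction 1 g with hGdef
  have hGQ : ∀ z, G (Q z) = g z := Function.Periodic.eq_cuspFunction one_ne_zero hg1'
  have hGd : ∀ z, DifferentiableAt ℂ g z → DifferentiableAt ℂ G (Q z) := fun z hz =>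
    Function.Periodic.differentiableAt_cuspFunction one_ne_zero hg1' hz
  have hQ0 : ∀ z, Q z ≠ 0 := fun z => Function.Periodic.qParam_ne_zero z
  have hQs : ∀ q, q ≠ 0 → ∃ z, Q z = q := fun q hq =>
    ⟨_, Function.Periodic.qParam_right_inv one_ne_zero hq⟩
  have hQadd : ∀ z w, Q (z + w) = Q z * Q w := fun z w => by
    simp only [hQ, Function.Periodic.qParam, ← Complex.exp_add]
    congr 1; ring
  have hQd : ∀ z, HasStrictDerivAt Q (Q z * (2 * Real.pi * Complex.I)) z := fun z => by
    have hQe : Q = fun z => Complex.exp (2 * Real.pi * Complex.I * z) := by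
      funext z
      simp [hQ, Function.Periodic.qParam]
    rw [hQe]
    simpa using ((hasStrictDerivAt_id z).const_mul (2 * Real.pi * Complex.I)).cexp
  have hQd0 : ∀ z, Q z * (2 * Real.pi * Complex.I) ≠ 0 := fun z =>
    mul_ne_zero (hQ0 z) Complex.two_pi_I_ne_zero
  have key := differentiableAt_of_mul_invariant_of_residues_on_ray (G := G) (hQ0 τ)
    (Function.Periodic.norm_qParam_lt_one one_pos hτ)
    (mul_ne_zero Complex.two_pi_I_ne_zero hu) ?_ ?_ ?_
  · intro z
    have : g = G ∘ Q := funext fun w => (hGQ w).symm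
    rw [this]
    exact (key _ (hQ0 z)).comp z (hQd z).hasDerivAt.differentiableAt
  · intro q hq
    obtain ⟨z, rfl⟩ := hQs q hq
    rw [← hQadd, hGQ, hGQ, add_comm, hgτ]
  · intro q hq
    obtain ⟨z, rfl⟩ := hQs q hq
    exact (hQd z).nhdsNE_le_map (hQd0 z) ((hdisc z).mono fun w hw => hGd w hw)
  · intro q hq hnd
    obtain ⟨z, rfl⟩ := hQs q hq
    obtain ⟨t, ht, hlim⟩ := hres z fun h => hnd (hGd z h)
    refine ⟨t, ht, Tendsto.mono_left ?_ ((hQd z).nhdsNE_le_map (hQd0 z))⟩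
    rw [tendsto_map'_iff]
    have h1 := hasDerivAt_iff_tendsto_slope.1 (hQd z).hasDerivAt
    have h2 : Tendsto (fun w => (Q w)⁻¹) (𝓝[≠] z) (𝓝 (Q z)⁻¹) :=
      ((hQd z).hasDerivAt.continuousAt.inv₀ (hQ0 z)).tendsto.mono_left nhdsWithin_le_nhds
    have h3 := (h1.mul h2).mul hlim
    have hval : Q z * (2 * Real.pi * Complex.I) * (Q z)⁻¹ * (u * t) =
        2 * Real.pi * Complex.I * u * t := by
      have := hQ0 z
      field_simp
    rw [hval] at h3
    refine h3.congr' ?_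
    filter_upwards [self_mem_nhdsWithin] with w hw
    have := sub_ne_zero.2 hw
    simp only [Function.comp_apply, slope_def_field, hGQ]
    field_simp

theorem Differentiable.exists_const_of_two_periods {f : ℂ → ℂ} (hf : Differentiable ℂ f)
    {ω₁ ω₂ : ℂ} (him : (ω₂ / ω₁).im ≠ 0) (h₁ : Function.Periodic f ω₁)
    (h₂ : Function.Periodic f ω₂) : ∃ a, ∀ z, f z = a := by
  have hω₁ : ω₁ ≠ 0 := by rintro rfl; simp at him
  let L : PeriodPair := ⟨ω₁, ω₂, by
    rw [LinearIndependent.pair_iff' hω₁]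
    rintro a rfl
    apply him
    rw [Complex.real_smul, mul_div_cancel_right₀ _ hω₁, Complex.ofReal_im]⟩
  refine hf.exists_const_forall_eq_of_bounded
    (IsZLattice.isCompact_range_of_periodic L.lattice f hf.continuous fun z w hw => ?_).isBounded
  obtain ⟨m, n, rfl⟩ := PeriodPair.mem_lattice.1 hw
  rw [← add_assoc, (h₂.int_mul n) _, (h₁.int_mul m) _]

/-- **Rigidity of elliptic functions with simple poles whose residues lie on the
half-ray `i·[0,∞)`** (the uniqueness argument in Theorem 2.8):
a doubly periodic function, holomorphic outside a discrete set `P` of poles,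
all of whose poles are simple with residue of the form `i c²` (`c ∈ ℝ`),
has no poles at all and is constant. -/
theorem elliptic_simple_poles_residues_on_halfray_constant
    (ω₁ ω₂ : ℂ) (hω₁ : ω₁ ≠ 0) (hω₂ : ω₂ ≠ 0) (him : 0 < (ω₂ / ω₁).im)
    (f : ℂ → ℂ) (P : Set ℂ)
    (hdisc : ∀ z ∈ P, ∀ᶠ w in 𝓝[≠] z, w ∉ P)
    (han : ∀ z ∉ P, AnalyticAt ℂ f z)
    (hper₁ : ∀ z, f (z + ω₁) = f z) (hper₂ : ∀ z, f (z + ω₂) = f z)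
    (hpole : ∀ z ∈ P, Tendsto (fun w => ‖f w‖) (𝓝[≠] z) atTop)
    (hres : ∀ z ∈ P, ∃ c : ℝ,
      Tendsto (fun w => (w - z) * f w) (𝓝[≠] z) (𝓝 (Complex.I * (c : ℂ) ^ 2))) :
    P = ∅ ∧ ∃ a : ℂ, ∀ z, f z = a := by
  have hnotdiff : ∀ z ∈ P, ¬ DifferentiableAt ℂ f z := fun z hz h =>
    not_tendsto_atTop_of_tendsto_nhds
      (h.continuousAt.norm.tendsto.mono_left nhdsWithin_le_nhds) (hpole z hz)
  have hdiff : ∀ z, ∀ᶠ w in 𝓝[≠] z, DifferentiableAt ℂ f w := by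
    intro z
    by_cases hz : z ∈ P
    · exact (hdisc z hz).mono fun w hw => (han w hw).differentiableAt
    · exact nhdsWithin_le_nhds
        ((han z hz).eventually_analyticAt.mono fun w hw => hw.differentiableAt)
  have hscale : ∀ z, Tendsto (fun w => ω₁ * w) (𝓝[≠] z) (𝓝[≠] (ω₁ * z)) := fun z =>
    tendsto_nhdsWithin_of_tendsto_nhds_of_eventually_within _
      ((continuous_const_mul ω₁).continuousAt.tendsto.mono_left nhdsWithin_le_nhds)
      (eventually_mem_nhdsWithin.mono fun w hw h => hw (mul_left_cancel₀ hω₁ h))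
  have hcomp : ∀ z, DifferentiableAt ℂ f (ω₁ * z) →
      DifferentiableAt ℂ (fun w => f (ω₁ * w)) z := fun z h =>
    h.comp z (differentiableAt_id.const_mul ω₁)
  have hg : Differentiable ℂ fun w => f (ω₁ * w) := by
    refine differentiable_of_periods_one_of_residues_on_ray (u := Complex.I / ω₁) him
      (div_ne_zero Complex.I_ne_zero hω₁) (fun z => ?_) (fun z => ?_)
      (fun z => ((hscale z).eventually (hdiff _)).mono hcomp) fun z hz => ?_
    · rw [mul_add, mul_one, hper₁]
    · rw [mul_add, mul_div_cancel₀ _ hω₁, hper₂]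
    · have hzP : ω₁ * z ∈ P := by
        by_contra h
        exact hz (hcomp z (han _ h).differentiableAt)
      obtain ⟨c, hc⟩ := hres _ hzP
      have hc0 : c ≠ 0 := by
        rintro rfl
        obtain ⟨l, hl⟩ := Complex.exists_tendsto_of_tendsto_sub_mul_zero (hdiff _)
          (by simpa using hc)
        exact not_tendsto_atTop_of_tendsto_nhds hl.norm (hpole _ hzP)
      refine ⟨c ^ 2, by positivity, ?_⟩
      have := (hc.comp (hscale z)).const_mul ω₁⁻¹
      rw [show Complex.I / ω₁ * ((c ^ 2 : ℝ) : ℂ) = ω₁⁻¹ * (Complex.I * (c : ℂ) ^ 2) by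
        push_cast; ring]
      refine this.congr fun w => ?_
      simp only [Function.comp_apply]
      field_simp
  have hf : Differentiable ℂ f := by
    have h := hg.comp (differentiable_id.const_mul ω₁⁻¹)
    have he : f = (fun w => f (ω₁ * w)) ∘ fun z => ω₁⁻¹ * id z := by
      funext z
      simp [mul_inv_cancel_left₀ hω₁]
    rwa [he]
  exact ⟨Set.eq_empty_of_forall_notMem fun z hz => hnotdiff z hz (hf z),
    hf.exists_const_of_two_periods him.ne' hper₁ hper₂⟩
end
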